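/- arXiv:1001.3090 — 8 statements merged into one kernel-verified Lean document; each statement's English description precedes it below -/
import Mathlib

section
/- Let Z be a finite set, let π⁰, π¹ ∈ P(Z) both have full support, and fix η ≥ 0. Let Z₁, Z₂, … be i.i.d. with marginal π⁰ under hypothesis H0 and marginal π¹ under hypothesis H1. The Hoeffding test is the sequence φᴴₙ = 1{D(Γⁿ‖π⁰) ≥ η}, where Γⁿ is the empirical distribution of (Z₁,…,Zₙ). Then: (a) J⁰_{φᴴ} ≥ η, and (b) for every test sequence φ = {φₙ : Zⁿ → {0,1}} with J⁰_φ ≥ η one has J¹_φ ≤ J¹_{φᴴ}; i.e., the Hoeffding test achieves the optimal error exponent J¹ among all tests whose exponent J⁰ is at least η. -/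
/-!
STATEMENT 0: Optimality of the Hoeffding test.

`KL μ π` is the Kullback–Leibler divergence `D(μ‖π)` on a finite observation
space `Z` (the formula below implements the convention `0·log 0 = 0`; it agrees
with `D(μ‖π)` whenever `π` has full support, as assumed here).
`emp n x` is the empirical distribution `Γⁿ` of the samples `x = (Z₁,…,Zₙ)`.
`law p` is the probability measure on a finite space with mass function `p`,
and `iidLaw π n` is the law of `n` i.i.d. observations with marginal `π`.
`errExp π φ b` is the error exponent `liminf_n −(1/n) log P_π(φₙ = b)`,
valued in `EReal` (with `ENNReal.log 0 = ⊥`, so zero-probability errors give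
exponent `+∞`, as they should).
`hoeffdingTest π0 η` is the Hoeffding test `φᴴₙ = 1{D(Γⁿ‖π⁰) ≥ η}`.
-/

open MeasureTheory Filter

noncomputable def KL {Z : Type*} [Fintype Z] (μ π : Z → ℝ) : ℝ :=
  ∑ z, μ z * Real.log (μ z / π z)

noncomputable def emp {Z : Type*} [Fintype Z] [DecidableEq Z] (n : ℕ)
    (x : Fin n → Z) : Z → ℝ :=
  fun z => (1 / (n : ℝ)) * ∑ k, if x k = z then (1 : ℝ) else 0

noncomputable def law {W : Type*} [Fintype W] [MeasurableSpace W] (p : W → ℝ) :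
    Measure W :=
  ∑ w, ENNReal.ofReal (p w) • Measure.dirac w

noncomputable def iidLaw {Z : Type*} [Fintype Z] [MeasurableSpace Z] (π : Z → ℝ)
    (n : ℕ) : Measure (Fin n → Z) :=
  law fun x => ∏ k, π (x k)

noncomputable def errExp {Z : Type*} [Fintype Z] [MeasurableSpace Z] (π : Z → ℝ)
    (φ : (n : ℕ) → (Fin n → Z) → Bool) (b : Bool) : EReal :=
  Filter.atTop.liminf fun n : ℕ =>
    (((-(1 / (n : ℝ))) : ℝ) : EReal) * ENNReal.log (iidLaw π n {x | φ n x = b})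

noncomputable def hoeffdingTest {Z : Type*} [Fintype Z] [DecidableEq Z]
    (π0 : Z → ℝ) (η : ℝ) : (n : ℕ) → (Fin n → Z) → Bool :=
  fun n x => if η ≤ KL (emp n x) π0 then true else false

section LargeDeviations

lemma prod_le_exp_mul_prod {Z : Type*} {μ π : Z → ℝ} (hμ : ∀ z, 0 ≤ μ z) (hπ : ∀ z, 0 < π z) {n : ℕ}
    (x : Fin n → Z) {c : ℝ} (hc : ∑ k, Real.log (μ (x k) / π (x k)) ≤ c) :
    ∏ k, μ (x k) ≤ Real.exp c * ∏ k, π (x k) := by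
  calc ∏ k, μ (x k) ≤ ∏ k, Real.exp (Real.log (μ (x k) / π (x k))) * π (x k) := by
        refine Finset.prod_le_prod (fun k _ => hμ (x k)) fun k _ => ?_
        have hle := mul_le_mul_of_nonneg_right (Real.le_exp_log (μ (x k) / π (x k)))
          (hπ (x k)).le
        rwa [div_mul_cancel₀ _ (hπ (x k)).ne'] at hle
    _ = Real.exp (∑ k, Real.log (μ (x k) / π (x k))) * ∏ k, π (x k) := by
        rw [Finset.prod_mul_distrib, Real.exp_sum]
    _ ≤ _ := by
        have : 0 ≤ ∏ k, π (x k) := Finset.prod_nonneg fun k _ => (hπ (x k)).le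
        gcongr

variable {Z : Type*} [Fintype Z]

lemma iidLaw_setOf [MeasurableSpace Z] [MeasurableSingletonClass Z] {π : Z → ℝ}
    (hπ : ∀ z, 0 ≤ π z) (n : ℕ) (p : (Fin n → Z) → Prop) [DecidablePred p] :
    iidLaw π n {x | p x} = ENNReal.ofReal (∑ x with p x, ∏ k, π (x k)) := by
  classical
  rw [ENNReal.ofReal_sum_of_nonneg fun x _ => Finset.prod_nonneg fun k _ => hπ (x k)]
  simp [iidLaw, law, Measure.finsetSum_apply, Set.indicator_apply, Finset.sum_filter]

lemma sum_prod_eq_one {μ : Z → ℝ} (hsum : ∑ z, μ z = 1) (n : ℕ) :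
    ∑ x : Fin n → Z, ∏ k, μ (x k) = 1 := by
  rw [← Fintype.sum_pow, hsum, one_pow]

section Empirical

variable [DecidableEq Z]

lemma sum_emp_mul {n : ℕ} (hn : n ≠ 0) (x : Fin n → Z) (g : Z → ℝ) :
    n * ∑ z, emp n x z * g z = ∑ k, g (x k) := by
  have hn' : (n : ℝ) ≠ 0 := by exact_mod_cast hn
  simp only [emp, mul_assoc, ← Finset.mul_sum, Finset.sum_mul]
  rw [Finset.sum_comm]
  simp [hn']

lemma emp_nonneg (n : ℕ) (x : Fin n → Z) (z : Z) : 0 ≤ emp n x z := by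
  unfold emp
  positivity

lemma sum_emp {n : ℕ} (hn : n ≠ 0) (x : Fin n → Z) : ∑ z, emp n x z = 1 := by
  have hn' : (n : ℝ) ≠ 0 := by exact_mod_cast hn
  have h := sum_emp_mul hn x fun _ => 1
  simp only [mul_one, Finset.sum_const, Finset.card_univ, Fintype.card_fin, nsmul_eq_mul] at h
  exact mul_left_cancel₀ hn' (by simpa using h)

lemma emp_apply_pos {n : ℕ} (x : Fin n → Z) (k : Fin n) : 0 < emp n x (x k) := by
  have hn : (0 : ℝ) < n := by exact_mod_cast k.pos
  refine mul_pos (by positivity) ?_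
  exact Finset.sum_pos' (fun i _ => by positivity) ⟨k, Finset.mem_univ k, by simp⟩

lemma prod_eq_prod_emp_mul_exp {π : Z → ℝ} (hπ : ∀ z, 0 < π z) {n : ℕ} (hn : n ≠ 0)
    (x : Fin n → Z) :
    ∏ k, π (x k) = (∏ k, emp n x (x k)) * Real.exp (-(n * KL (emp n x) π)) := by
  rw [KL, sum_emp_mul hn x fun z => Real.log (emp n x z / π z), ← Finset.sum_neg_distrib,
    Real.exp_sum, ← Finset.prod_mul_distrib]
  refine Finset.prod_congr rfl fun k _ => ?_
  have h := emp_apply_pos x k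
  have h' := hπ (x k)
  rw [Real.exp_neg, Real.exp_log (div_pos h h'), inv_div]
  field_simp

lemma card_image_emp_le (n : ℕ) :
    (Finset.univ.image (emp n : (Fin n → Z) → Z → ℝ)).card ≤ (n + 1) ^ Fintype.card Z := by
  let count : (Fin n → Z) → Z → Fin (n + 1) := fun x z =>
    ⟨({k | x k = z} : Finset (Fin n)).card,
      Nat.lt_succ_of_le ((Finset.card_le_univ _).trans_eq (Fintype.card_fin n))⟩
  have h : (emp n : (Fin n → Z) → Z → ℝ) =
      (fun (c : Z → Fin (n + 1)) z => (1 / (n : ℝ)) * ((c z : ℕ) : ℝ)) ∘ count := by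
    ext x z
    simp [emp, count]
  rw [h, ← Finset.image_image]
  exact (Finset.card_image_le.trans (Finset.card_le_univ _)).trans_eq (by simp)

lemma sum_prod_emp_le {n : ℕ} (hn : n ≠ 0) :
    ∑ x : Fin n → Z, ∏ k, emp n x (x k) ≤ ((n : ℝ) + 1) ^ Fintype.card Z := by
  set T := Finset.univ.image (emp n : (Fin n → Z) → Z → ℝ)
  calc ∑ x : Fin n → Z, ∏ k, emp n x (x k)
      ≤ ∑ x : Fin n → Z, ∑ q ∈ T, ∏ k, q (x k) := by
        refine Finset.sum_le_sum fun x _ =>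
          Finset.single_le_sum (f := fun q : Z → ℝ => ∏ k, q (x k)) (fun q hq => ?_)
            (Finset.mem_image_of_mem _ (Finset.mem_univ x))
        obtain ⟨y, -, rfl⟩ := Finset.mem_image.1 hq
        exact Finset.prod_nonneg fun k _ => emp_nonneg n y (x k)
    _ = ∑ q ∈ T, ∑ x : Fin n → Z, ∏ k, q (x k) := Finset.sum_comm
    _ = ∑ q ∈ T, 1 := by
        refine Finset.sum_congr rfl fun q hq => ?_
        obtain ⟨y, -, rfl⟩ := Finset.mem_image.1 hq
        exact sum_prod_eq_one (sum_emp hn y) n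
    _ ≤ ((n : ℝ) + 1) ^ Fintype.card Z := by
        rw [Finset.sum_const, nsmul_eq_mul, mul_one]
        exact_mod_cast card_image_emp_le n

/-- Sanov's upper bound, by the method of types. -/
lemma sum_prod_le_of_le_KL {π : Z → ℝ} (hπ : ∀ z, 0 < π z) {n : ℕ} (hn : n ≠ 0)
    (p : (Fin n → Z) → Prop) [DecidablePred p] {c : ℝ} (hc : ∀ x, p x → c ≤ KL (emp n x) π) :
    ∑ x with p x, ∏ k, π (x k) ≤ ((n : ℝ) + 1) ^ Fintype.card Z * Real.exp (-(n * c)) := by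
  have hnn (x : Fin n → Z) : 0 ≤ ∏ k, emp n x (x k) :=
    Finset.prod_nonneg fun k _ => emp_nonneg n x (x k)
  calc ∑ x with p x, ∏ k, π (x k)
      ≤ ∑ x with p x, (∏ k, emp n x (x k)) * Real.exp (-(n * c)) := by
        refine Finset.sum_le_sum fun x hx => ?_
        rw [prod_eq_prod_emp_mul_exp hπ hn x]
        have := hc x (Finset.mem_filter.1 hx).2
        have := hnn x
        gcongr
    _ ≤ ∑ x, (∏ k, emp n x (x k)) * Real.exp (-(n * c)) :=
        Finset.sum_le_sum_of_subset_of_nonneg (Finset.filter_subset _ _)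
          fun x _ _ => mul_nonneg (hnn x) (Real.exp_pos _).le
    _ ≤ _ := by
        rw [← Finset.sum_mul]
        gcongr
        exact sum_prod_emp_le hn

end Empirical

lemma exists_sum_mul_exp_lt_one {μ g : Z → ℝ} (hsum : ∑ z, μ z = 1) (hg : ∑ z, μ z * g z < 0) :
    ∃ t > 0, ∑ z, μ z * Real.exp (t * g z) < 1 := by
  have hd : HasDerivAt (fun t : ℝ => ∑ z, μ z * Real.exp (t * g z)) (∑ z, μ z * g z) 0 := by
    refine HasDerivAt.fun_sum fun z _ => ?_
    simpa using ((hasDerivAt_id (0 : ℝ)).mul_const (g z)).exp.const_mul (μ z)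
  have hslope := hd.tendsto_slope_zero_right.eventually_lt_const hg
  obtain ⟨t, hlt, ht⟩ := (hslope.and self_mem_nhdsWithin).exists
  refine ⟨t, ht, ?_⟩
  simp only [zero_add, zero_mul, Real.exp_zero, mul_one, hsum, smul_eq_mul] at hlt
  exact sub_neg.1 ((pos_iff_neg_of_mul_neg hlt).1 (inv_pos.2 ht))

/-- Chernoff's bound for i.i.d. sums, in qualitative form. -/
lemma exists_chernoff_bound {μ : Z → ℝ} (hμ : ∀ z, 0 ≤ μ z) (hsum : ∑ z, μ z = 1) (f : Z → ℝ)
    {a : ℝ} (ha : ∑ z, μ z * f z < a) :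
    ∃ ρ, 0 ≤ ρ ∧ ρ < 1 ∧
      ∀ n : ℕ, ∑ x : Fin n → Z with n * a ≤ ∑ k, f (x k), ∏ k, μ (x k) ≤ ρ ^ n := by
  have hg : ∑ z, μ z * (f z - a) < 0 := by
    simp only [mul_sub, Finset.sum_sub_distrib, ← Finset.sum_mul, hsum]
    linarith
  obtain ⟨t, ht, hlt⟩ := exists_sum_mul_exp_lt_one hsum hg
  refine ⟨_, Finset.sum_nonneg fun z _ => mul_nonneg (hμ z) (Real.exp_pos _).le, hlt, fun n => ?_⟩
  rw [Fintype.sum_pow]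
  have hnn (x : Fin n → Z) : 0 ≤ ∏ k, μ (x k) := Finset.prod_nonneg fun k _ => hμ (x k)
  have hprod (x : Fin n → Z) : ∏ k, μ (x k) * Real.exp (t * (f (x k) - a)) =
      (∏ k, μ (x k)) * Real.exp (t * (∑ k, f (x k) - n * a)) := by
    rw [Finset.prod_mul_distrib, ← Real.exp_sum, ← Finset.mul_sum, Finset.sum_sub_distrib]
    simp
  simp only [hprod]
  refine (Finset.sum_le_sum fun x hx => ?_).trans
    (Finset.sum_le_sum_of_subset_of_nonneg (Finset.filter_subset _ _)
      fun x _ _ => mul_nonneg (hnn x) (Real.exp_pos _).le)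
  refine le_mul_of_one_le_right (hnn x) (Real.one_le_exp (mul_nonneg ht.le ?_))
  linarith [(Finset.mem_filter.1 hx).2]

/-- Change of measure: the `μ`-probability of accepting is controlled by the two error
probabilities and the probabilities of large log-likelihood ratios. -/
lemma one_le_change_of_measure {μ π0 π1 : Z → ℝ} (hμ : ∀ z, 0 ≤ μ z) (hsum : ∑ z, μ z = 1)
    (h0 : ∀ z, 0 < π0 z) (h1 : ∀ z, 0 < π1 z) {n : ℕ} (ψ : (Fin n → Z) → Bool) (a b : ℝ) :
    1 ≤ Real.exp (n * a) * (∑ x with ψ x = true, ∏ k, π0 (x k)) +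
      Real.exp (n * b) * (∑ x with ψ x = false, ∏ k, π1 (x k)) +
      (∑ x : Fin n → Z with n * a ≤ ∑ k, Real.log (μ (x k) / π0 (x k)), ∏ k, μ (x k)) +
      ∑ x : Fin n → Z with n * b ≤ ∑ k, Real.log (μ (x k) / π1 (x k)), ∏ k, μ (x k) := by
  rw [← sum_prod_eq_one hsum n]
  simp only [Finset.sum_filter, Finset.mul_sum, ← Finset.sum_add_distrib]
  refine Finset.sum_le_sum fun x _ => ?_
  have hm : 0 ≤ ∏ k, μ (x k) := Finset.prod_nonneg fun k _ => hμ (x k)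
  have hp0 : 0 ≤ ∏ k, π0 (x k) := Finset.prod_nonneg fun k _ => (h0 (x k)).le
  have hp1 : 0 ≤ ∏ k, π1 (x k) := Finset.prod_nonneg fun k _ => (h1 (x k)).le
  have e0 := mul_nonneg (Real.exp_pos (n * a)).le hp0
  have e1 := mul_nonneg (Real.exp_pos (n * b)).le hp1
  by_cases ha : n * a ≤ ∑ k, Real.log (μ (x k) / π0 (x k))
  · cases ψ x <;> simp only [ha, if_true, mul_ite, mul_zero] <;> split_ifs <;> linarith
  by_cases hb : n * b ≤ ∑ k, Real.log (μ (x k) / π1 (x k))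
  · cases ψ x <;> simp only [hb, if_true, mul_ite, mul_zero] <;> split_ifs <;> linarith
  have i0 := prod_le_exp_mul_prod hμ h0 x (not_le.1 ha).le
  have i1 := prod_le_exp_mul_prod hμ h1 x (not_le.1 hb).le
  cases hψ : ψ x <;> simp [ha, hb, i0, i1]

lemma le_neg_inv_mul_log_iff {n : ℕ} (hn : n ≠ 0) (P : ENNReal) (c : ℝ) :
    (c : EReal) ≤ ((-(1 / (n : ℝ)) : ℝ) : EReal) * ENNReal.log P ↔
      P ≤ ENNReal.ofReal (Real.exp (-(n * c))) := by
  have hn' : (0 : ℝ) < n := by positivity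
  have hneg : -(1 / (n : ℝ)) < 0 := by simpa using hn'
  rcases eq_or_ne P 0 with rfl | h0
  · rw [ENNReal.log_zero, EReal.coe_mul_bot_of_neg hneg]
    simp
  rcases eq_or_ne P ⊤ with rfl | htop
  · rw [ENNReal.log_top, EReal.coe_mul_top_of_neg hneg]
    simp
  have hP : 0 < P.toReal := ENNReal.toReal_pos h0 htop
  rw [ENNReal.log_pos_real h0 htop, ← EReal.coe_mul, EReal.coe_le_coe_iff,
    ← ENNReal.toReal_le_toReal htop ENNReal.ofReal_ne_top,
    ENNReal.toReal_ofReal (Real.exp_pos _).le, ← Real.log_le_iff_le_exp hP]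
  constructor <;> intro h
  · have := mul_le_mul_of_nonneg_left h hn'.le
    field_simp at this
    linarith
  · field_simp
    linarith

lemma tendsto_log_succ_div (d : ℕ) :
    Tendsto (fun n : ℕ => d * Real.log (n + 1) / n) atTop (nhds 0) := by
  have h := (Real.tendsto_pow_log_div_mul_add_atTop 1 (-1) 1 one_ne_zero).comp
    (tendsto_atTop_add_const_right atTop (1 : ℝ) tendsto_natCast_atTop_atTop)
  simpa [Function.comp_def, mul_div_assoc] using h.const_mul (d : ℝ)

lemma le_errExp_of_sum_prod_le [MeasurableSpace Z] [MeasurableSingletonClass Z] {π : Z → ℝ}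
    (hπ : ∀ z, 0 ≤ π z) (φ : (n : ℕ) → (Fin n → Z) → Bool) (b : Bool) (d : ℕ) (c : ℝ)
    (h : ∀ n : ℕ, n ≠ 0 → ∑ x with φ n x = b, ∏ k, π (x k) ≤
      ((n : ℝ) + 1) ^ d * Real.exp (-(n * c))) :
    (c : EReal) ≤ errExp π φ b := by
  refine EReal.ge_of_forall_gt_iff_ge.1 fun r hr => ?_
  have hr' : r < c := by exact_mod_cast hr
  refine le_liminf_of_le (by isBoundedDefault) ?_
  filter_upwards [(tendsto_log_succ_div d).eventually_lt_const (sub_pos.2 hr'),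
    eventually_ne_atTop 0] with n hlt hn
  have hn' : (0 : ℝ) < n := by positivity
  rw [le_neg_inv_mul_log_iff hn, iidLaw_setOf hπ]
  refine ENNReal.ofReal_le_ofReal ((h n hn).trans ?_)
  rw [← Real.exp_log (show (0 : ℝ) < (n + 1) ^ d by positivity), ← Real.exp_add, Real.log_pow]
  rw [div_lt_iff₀ hn'] at hlt
  refine Real.exp_le_exp.2 ?_
  linarith

lemma errExp_le_KL [MeasurableSpace Z] [MeasurableSingletonClass Z] {μ π0 π1 : Z → ℝ}
    (hμ : ∀ z, 0 ≤ μ z) (hsum : ∑ z, μ z = 1) (h0 : ∀ z, 0 < π0 z) (h1 : ∀ z, 0 < π1 z)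
    {η : ℝ} (φ : (n : ℕ) → (Fin n → Z) → Bool) (hφ : (η : EReal) ≤ errExp π0 φ true)
    (hη : KL μ π0 < η) : errExp π1 φ false ≤ KL μ π1 := by
  refine EReal.le_of_forall_lt_iff_le.1 fun b hb => ?_
  have hb' : KL μ π1 < b := by exact_mod_cast hb
  obtain ⟨r, hr, hrb⟩ := exists_between hb'
  obtain ⟨a, ha, haη⟩ := exists_between hη
  obtain ⟨c, hac, hcη⟩ := exists_between haη
  obtain ⟨ρ, hρ0, hρ1, hρ⟩ := exists_chernoff_bound hμ hsum (fun z => Real.log (μ z / π0 z)) ha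
  obtain ⟨σ, hσ0, hσ1, hσ⟩ := exists_chernoff_bound hμ hsum (fun z => Real.log (μ z / π1 z)) hr
  have hev : ∀ᶠ n : ℕ in atTop, (c : EReal) <
      ((-(1 / (n : ℝ)) : ℝ) : EReal) * ENNReal.log (iidLaw π0 n {x | φ n x = true}) :=
    eventually_lt_of_lt_liminf ((EReal.coe_lt_coe_iff.2 hcη).trans_le hφ)
  have hlim : Tendsto (fun n : ℕ => Real.exp (-(c - a)) ^ n + ρ ^ n + σ ^ n +
      Real.exp (-(b - r)) ^ n) atTop (nhds 0) := by
    have hexp {s : ℝ} (hs : 0 < s) :=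
      tendsto_pow_atTop_nhds_zero_of_lt_one (Real.exp_pos (-s)).le (by simpa using hs)
    simpa using (((hexp (sub_pos.2 hac)).add
      (tendsto_pow_atTop_nhds_zero_of_lt_one hρ0 hρ1)).add
      (tendsto_pow_atTop_nhds_zero_of_lt_one hσ0 hσ1)).add (hexp (sub_pos.2 hrb))
  refine liminf_le_of_frequently_le (Eventually.frequently ?_) (by isBoundedDefault)
  filter_upwards [hev, hlim.eventually_lt_const one_pos, eventually_ne_atTop 0] with n hn hsmall hn0
  by_contra! hcon
  have hP0 := (le_neg_inv_mul_log_iff hn0 _ _).1 hn.le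
  have hP1 := (le_neg_inv_mul_log_iff hn0 _ _).1 hcon.le
  rw [iidLaw_setOf fun z => (h0 z).le, ENNReal.ofReal_le_ofReal_iff (Real.exp_pos _).le] at hP0
  rw [iidLaw_setOf fun z => (h1 z).le, ENNReal.ofReal_le_ofReal_iff (Real.exp_pos _).le] at hP1
  have hmain := one_le_change_of_measure hμ hsum h0 h1 (φ n) a r
  have hexp (u v : ℝ) : Real.exp (n * u) * Real.exp (-(n * v)) = Real.exp (-(v - u)) ^ n := by
    rw [← Real.exp_add, ← Real.exp_nat_mul]
    ring_nf
  have k0 := mul_le_mul_of_nonneg_left hP0 (Real.exp_pos (n * a)).le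
  have k1 := mul_le_mul_of_nonneg_left hP1 (Real.exp_pos (n * r)).le
  rw [hexp] at k0 k1
  linarith [hρ n, hσ n]

end LargeDeviations

/-- The Hoeffding test `φᴴ` satisfies `J⁰_{φᴴ} ≥ η`, and achieves the optimal
error exponent `J¹` among all test sequences `φ` with `J⁰_φ ≥ η`. -/
theorem hoeffding_test_optimal {Z : Type*} [Fintype Z] [DecidableEq Z]
    [MeasurableSpace Z] [MeasurableSingletonClass Z]
    (π0 π1 : Z → ℝ) (h0pos : ∀ z, 0 < π0 z) (h0sum : ∑ z, π0 z = 1)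
    (h1pos : ∀ z, 0 < π1 z) (h1sum : ∑ z, π1 z = 1)
    (η : ℝ) (hη : 0 ≤ η) :
    (η : EReal) ≤ errExp π0 (hoeffdingTest π0 η) true ∧
      ∀ φ : (n : ℕ) → (Fin n → Z) → Bool,
        (η : EReal) ≤ errExp π0 φ true →
          errExp π1 φ false ≤ errExp π1 (hoeffdingTest π0 η) false := by
  refine ⟨?_, fun φ hφ => ?_⟩
  · refine le_errExp_of_sum_prod_le (fun z => (h0pos z).le) _ _ (Fintype.card Z) η
      fun n hn => sum_prod_le_of_le_KL h0pos hn _ fun x hx => ?_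
    simpa [hoeffdingTest] using hx
  · refine EReal.ge_of_forall_gt_iff_ge.1 fun c hc => ?_
    refine le_errExp_of_sum_prod_le (fun z => (h1pos z).le) _ _ (Fintype.card Z) c
      fun n hn => sum_prod_le_of_le_KL h1pos hn _ fun x hx => ?_
    have hx' : KL (emp n x) π0 < η := by simpa [hoeffdingTest] using hx
    exact_mod_cast hc.le.trans
      (errExp_le_KL (emp_nonneg n x) (sum_emp hn x) h0pos h1pos φ hφ hx')
end

section
/- Let Z be a finite set, let π⁰, π¹, …, π^p ∈ P(Z) all have full support (hence be mutually absolutely continuous), and let F be a linear class of functions on Z. Then D^MM_F(πⁱ‖πʲ) = D(πⁱ‖πʲ) for all 0 ≤ i, j ≤ p with i ≠ j if and only if πⁱ ∈ E(π⁰, F) for all 0 ≤ i ≤ p. -/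
noncomputable def DmmSet {Z : Type*} [Fintype Z] (F : Set (Z → ℝ))
    (μ π : Z → ℝ) : ℝ :=
  sSup {v : ℝ | ∃ f ∈ F,
    v = (∑ z, μ z * f z) - Real.log (∑ z, π z * Real.exp (f z))}

noncomputable def expFam {Z : Type*} [Fintype Z] (ν : Z → ℝ)
    (F : Set (Z → ℝ)) : Set (Z → ℝ) :=
  {μ | ∃ f ∈ F, μ = fun z => ν z * Real.exp (f z) / ∑ z', ν z' * Real.exp (f z')}

theorem Real.min_le_exp_sub_one_sub (t : ℝ) : min (t ^ 2 / 4) 1 ≤ Real.exp t - 1 - t := by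
  by_cases ht : -2 ≤ t
  · refine (min_le_left _ _).trans ?_
    have h1 : t / 2 + 1 ≤ Real.exp (t / 2) := Real.add_one_le_exp _
    have h2 : Real.exp t = Real.exp (t / 2) ^ 2 := by
      rw [← Real.exp_nat_mul]
      congr 1
      push_cast
      ring
    nlinarith
  · refine (min_le_right _ _).trans ?_
    linarith [Real.exp_pos t]

/-- The gap between the divergence and the mismatched objective at `f`, as a sum of nonnegative
terms. -/
theorem KL_sub_objective_eq {Z : Type*} [Fintype Z] {μ π : Z → ℝ}
    (hμ : ∀ z, 0 < μ z) (hπ : ∀ z, 0 < π z) (hμ1 : ∑ z, μ z = 1) (f : Z → ℝ) :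
    KL μ π - ((∑ z, μ z * f z) - Real.log (∑ z, π z * Real.exp (f z))) =
      ∑ z, μ z * (Real.exp (f z - Real.log (∑ z, π z * Real.exp (f z)) - Real.log (μ z / π z))
        - 1 - (f z - Real.log (∑ z, π z * Real.exp (f z)) - Real.log (μ z / π z))) := by
  have hne : (Finset.univ : Finset Z).Nonempty :=
    Finset.nonempty_of_sum_ne_zero (hμ1.trans_ne one_ne_zero)
  set c := ∑ z, π z * Real.exp (f z) with hc
  have hcpos : 0 < c := Finset.sum_pos (fun z _ => mul_pos (hπ z) (Real.exp_pos _)) hne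
  have hterm : ∀ z, μ z * (Real.exp (f z - Real.log c - Real.log (μ z / π z))
        - 1 - (f z - Real.log c - Real.log (μ z / π z))) =
      (π z * Real.exp (f z)) / c - μ z - μ z * f z + μ z * Real.log c
        + μ z * Real.log (μ z / π z) := by
    intro z
    rw [Real.exp_sub, Real.exp_sub, Real.exp_log hcpos, Real.exp_log (div_pos (hμ z) (hπ z))]
    have h1 := (hμ z).ne'
    have h2 := (hπ z).ne'
    field_simp
    ring
  simp_rw [hterm, Finset.sum_add_distrib, Finset.sum_sub_distrib, ← Finset.sum_div,
    ← Finset.sum_mul]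
  rw [← hc, div_self hcpos.ne', hμ1, KL]
  ring

theorem objective_le_KL {Z : Type*} [Fintype Z] {μ π : Z → ℝ}
    (hμ : ∀ z, 0 < μ z) (hπ : ∀ z, 0 < π z) (hμ1 : ∑ z, μ z = 1) (f : Z → ℝ) :
    (∑ z, μ z * f z) - Real.log (∑ z, π z * Real.exp (f z)) ≤ KL μ π := by
  rw [← sub_nonneg, KL_sub_objective_eq hμ hπ hμ1]
  refine Finset.sum_nonneg fun z _ => mul_nonneg (hμ z).le ?_
  refine le_trans ?_ (Real.min_le_exp_sub_one_sub _)
  positivity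

theorem mem_expFam_of_log_div_eq {Z : Type*} [Fintype Z] {μ π : Z → ℝ}
    (hμ : ∀ z, 0 < μ z) (hπ : ∀ z, 0 < π z) (hμ1 : ∑ z, μ z = 1) {F : Set (Z → ℝ)}
    {f : Z → ℝ} (hf : f ∈ F) {c : ℝ} (h : ∀ z, Real.log (μ z / π z) = f z + c) :
    μ ∈ expFam π F := by
  have hμeq : ∀ z, μ z = π z * Real.exp (f z) * Real.exp c := by
    intro z
    rw [mul_assoc, ← Real.exp_add, ← h z, Real.exp_log (div_pos (hμ z) (hπ z)),
      mul_div_cancel₀ _ (hπ z).ne']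
  have hs : (∑ z, π z * Real.exp (f z)) * Real.exp c = 1 := by
    rw [Finset.sum_mul, ← hμ1]
    exact Finset.sum_congr rfl fun z _ => (hμeq z).symm
  refine ⟨f, hf, funext fun z => ?_⟩
  rw [hμeq z, eq_div_iff (left_ne_zero_of_mul_eq_one hs), mul_assoc, mul_comm (Real.exp c), hs,
    mul_one]

theorem mem_expFam_of_DmmSet_eq_KL {Z : Type*} [Fintype Z] {μ π : Z → ℝ}
    (hμ : ∀ z, 0 < μ z) (hπ : ∀ z, 0 < π z) (hμ1 : ∑ z, μ z = 1) (F : Submodule ℝ (Z → ℝ))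
    (h : DmmSet (F : Set (Z → ℝ)) μ π = KL μ π) : μ ∈ expFam π (F : Set (Z → ℝ)) := by
  let W : Submodule ℝ (Z → ℝ) := F ⊔ Submodule.span ℝ {1}
  have hmem : (fun z => Real.log (μ z / π z)) ∈ W := by
    have hclosed : IsClosed (W : Set (Z → ℝ)) := W.closed_of_finiteDimensional
    rw [← SetLike.mem_coe, ← hclosed.closure_eq, Metric.mem_closure_iff]
    intro ε hε
    have hne : (Finset.univ : Finset Z).Nonempty :=
      Finset.nonempty_of_sum_ne_zero (hμ1.trans_ne one_ne_zero)
    obtain ⟨z₀, -, hz₀⟩ := Finset.exists_min_image Finset.univ μ hne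
    have hη : 0 < min (ε ^ 2 / 4) 1 := by positivity
    have hlt : KL μ π - μ z₀ * min (ε ^ 2 / 4) 1 < DmmSet (F : Set (Z → ℝ)) μ π := by
      rw [h]
      linarith [mul_pos (hμ z₀) hη]
    unfold DmmSet at hlt
    obtain ⟨_, ⟨f, hf, rfl⟩, hv⟩ := exists_lt_of_lt_csSup (by exact ⟨_, 0, F.zero_mem, rfl⟩) hlt
    have hgap := KL_sub_objective_eq hμ hπ hμ1 f
    set c := ∑ z, π z * Real.exp (f z)
    refine ⟨f - Real.log c • 1, W.sub_mem (Submodule.mem_sup_left hf)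
      (W.smul_mem _ (Submodule.mem_sup_right (Submodule.mem_span_singleton_self _))), ?_⟩
    rw [dist_comm, dist_pi_lt_iff hε]
    intro z
    have hz : (f - Real.log c • (1 : Z → ℝ)) z = f z - Real.log c := by simp
    rw [hz, Real.dist_eq]
    have hle := Finset.single_le_sum (f := fun z => μ z * (Real.exp (f z - Real.log c
        - Real.log (μ z / π z)) - 1 - (f z - Real.log c - Real.log (μ z / π z))))
      (fun z _ => mul_nonneg (hμ z).le
        (le_trans (by positivity) (Real.min_le_exp_sub_one_sub _))) (Finset.mem_univ z)
    rw [← hgap] at hle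
    set t := f z - Real.log c - Real.log (μ z / π z)
    have h1 : μ z * min (t ^ 2 / 4) 1 < μ z * min (ε ^ 2 / 4) 1 := by
      have := mul_le_mul_of_nonneg_left (Real.min_le_exp_sub_one_sub t) (hμ z).le
      have := mul_le_mul_of_nonneg_right (hz₀ z (Finset.mem_univ z)) hη.le
      linarith
    have h2 := lt_of_mul_lt_mul_left h1 (hμ z).le
    by_contra! hεt
    refine h2.not_ge (min_le_min_right _ ?_)
    have : ε ^ 2 ≤ |t| ^ 2 := by gcongr
    rw [sq_abs] at this
    linarith
  obtain ⟨f, hf, g, hg, hfg⟩ := Submodule.mem_sup.1 hmem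
  obtain ⟨c, rfl⟩ := Submodule.mem_span_singleton.1 hg
  refine mem_expFam_of_log_div_eq hμ hπ hμ1 hf (c := c) fun z => ?_
  simpa using (congrFun hfg z).symm

theorem DmmSet_eq_KL_of_mem_expFam {Z : Type*} [Fintype Z] {ν μ π : Z → ℝ}
    (hν : ∀ z, 0 < ν z) (hμ : ∀ z, 0 < μ z) (hπ : ∀ z, 0 < π z) (hμ1 : ∑ z, μ z = 1)
    (F : Submodule ℝ (Z → ℝ)) (hμF : μ ∈ expFam ν (F : Set (Z → ℝ)))
    (hπF : π ∈ expFam ν (F : Set (Z → ℝ))) :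
    DmmSet (F : Set (Z → ℝ)) μ π = KL μ π := by
  obtain ⟨f, hf, hμf⟩ := hμF
  obtain ⟨g, hg, hπg⟩ := hπF
  have hne : (Finset.univ : Finset Z).Nonempty :=
    Finset.nonempty_of_sum_ne_zero (hμ1.trans_ne one_ne_zero)
  set a := ∑ z, ν z * Real.exp (f z)
  set b := ∑ z, ν z * Real.exp (g z)
  have ha : 0 < a := Finset.sum_pos (fun z _ => mul_pos (hν z) (Real.exp_pos _)) hne
  have hb : 0 < b := Finset.sum_pos (fun z _ => mul_pos (hν z) (Real.exp_pos _)) hne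
  have hμπ : ∀ z, π z * Real.exp ((f - g) z) = μ z * (a / b) := by
    intro z
    rw [hμf, hπg, Pi.sub_apply, Real.exp_sub]
    have := (Real.exp_pos (g z)).ne'
    field_simp
  have hsum : ∑ z, π z * Real.exp ((f - g) z) = a / b := by
    simp_rw [hμπ, ← Finset.sum_mul, hμ1, one_mul]
  have hlog : ∀ z, Real.log (μ z / π z) = (f - g) z - Real.log (a / b) := by
    intro z
    have : μ z / π z = Real.exp ((f - g) z) / (a / b) := by
      rw [div_eq_div_iff (hπ z).ne' (div_pos ha hb).ne', ← hμπ z, mul_comm]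
    rw [this, Real.log_div (Real.exp_pos _).ne' (div_pos ha hb).ne', Real.log_exp]
  refine IsGreatest.csSup_eq ⟨⟨f - g, F.sub_mem hf hg, ?_⟩, ?_⟩
  · simp_rw [hsum, KL, hlog, mul_sub, Finset.sum_sub_distrib, ← Finset.sum_mul, hμ1, one_mul]
  · rintro _ ⟨k, -, rfl⟩
    exact objective_le_KL hμ hπ hμ1 k

theorem mismatched_exact_iff_expFam {Z : Type*} [Fintype Z] {p : ℕ}
    (π : Fin (p + 1) → Z → ℝ)
    (hpos : ∀ i z, 0 < π i z) (hsum : ∀ i, ∑ z, π i z = 1)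
    (F : Submodule ℝ (Z → ℝ)) :
    (∀ i j : Fin (p + 1), i ≠ j →
        DmmSet (F : Set (Z → ℝ)) (π i) (π j) = KL (π i) (π j)) ↔
      ∀ i : Fin (p + 1), π i ∈ expFam (π 0) (F : Set (Z → ℝ)) := by
  constructor
  · intro h i
    rcases eq_or_ne i 0 with rfl | hi
    · exact mem_expFam_of_log_div_eq (hpos 0) (hpos 0) (hsum 0) F.zero_mem (c := 0)
        fun z => by simp [(hpos 0 z).ne']
    · exact mem_expFam_of_DmmSet_eq_KL (hpos i) (hpos 0) (hsum i) F (h i 0 hi)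
  · intro h i j _
    exact DmmSet_eq_KL_of_mem_expFam (hpos 0) (hpos i) (hpos j) (hsum i) F (h i) (h j)
end

section
/- Let Z be a finite set, let ν ∈ P(Z) have full support, and let F = {Σ_{i=1}^d r_i ψ_i : r ∈ ℝ^d} be a linear function class with minimal basis. Let E = E(ν, F) and suppose N = N(E) is finite and N ≥ 2. Then there exists a sequence of sets A⁽¹⁾, A⁽²⁾, … ⊆ E, each of cardinality N, such that D^MM_F(π‖π′) = D(π‖π′) for all π, π′ ∈ A⁽ᵏ⁾ and every k, and lim_{k→∞} min{ D^MM_F(π‖π′) : π, π′ ∈ A⁽ᵏ⁾, π ≠ π′ } = ∞. -/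
/-!
STATEMENT 6: The mismatched test is effective against `N(E)` distributions.

Definitions (on a finite nonempty set `Z`):
* `KL μ π` : KL divergence; `DmmLin ψ μ π` : mismatched divergence for the
  linear class spanned by `ψ₁,…,ψ_d`.
* `Feps ε x = {z : x(z) ≥ max x − ε}`; `distinguishable ε` and `extremal ε`
  are ε-distinguishability and ε-extremality.
* `distinguishProp E N` : there is `ε₀ > 0` such that for every `0 < ε < ε₀`
  there is an ε-extremal `A ⊆ E` with `|A| ≥ N` whose members are pairwise
  ε-distinguishable. `N(E)` is the maximum such `N`, encoded by the
  hypotheses `BddAbove`, `N = sSup {...}`.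
* `expFam ν F` : the exponential family `E(ν, F)`.

Theorem: for `E = E(ν, F)` with `ν` of full support and `F` spanned by a
minimal basis, if `N = N(E)` is finite and `N ≥ 2`, there are sets
`A⁽¹⁾, A⁽²⁾, … ⊆ E` of cardinality `N` on which `D^MM_F` equals `D`, with
`min {D^MM_F(π‖π') : π ≠ π' ∈ A⁽ᵏ⁾} → ∞` as `k → ∞`.
-/

open Filter

noncomputable def DmmLin {Z : Type*} [Fintype Z] {d : ℕ} (ψ : Fin d → Z → ℝ)
    (μ π : Z → ℝ) : ℝ :=
  ⨆ r : Fin d → ℝ,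
    ((∑ z, μ z * ∑ i, r i * ψ i z) -
      Real.log (∑ z, π z * Real.exp (∑ i, r i * ψ i z)))

noncomputable def Feps {Z : Type*} [Fintype Z] (ε : ℝ) (x : Z → ℝ) : Set Z :=
  {z | (⨆ z', x z') - ε ≤ x z}

def distinguishable {Z : Type*} [Fintype Z] (ε : ℝ) (x y : Z → ℝ) : Prop :=
  (Feps ε x \ Feps ε y).Nonempty ∧ (Feps ε y \ Feps ε x).Nonempty

def extremal {Z : Type*} [Fintype Z] (ε : ℝ) (x : Z → ℝ) : Prop :=
  1 - ε ≤ ∑ z, (Feps ε x).indicator x z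

def distinguishProp {Z : Type*} [Fintype Z] (E : Set (Z → ℝ)) (N : ℕ) : Prop :=
  ∃ ε₀ > (0 : ℝ), ∀ ε : ℝ, 0 < ε → ε < ε₀ →
    ∃ A : Finset (Z → ℝ), ↑A ⊆ E ∧ N ≤ A.card ∧
      (∀ π ∈ A, extremal ε π) ∧
      ∀ π ∈ A, ∀ π' ∈ A, π ≠ π' → distinguishable ε π π'

theorem sub_le_mul_log_div {x y : ℝ} (hx : 0 < x) (hy : 0 < y) :
    x - y ≤ x * Real.log (x / y) := by
  have h := Real.log_le_sub_one_of_pos (div_pos hy hx)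
  have h1 : Real.log (x / y) = -Real.log (y / x) := by
    rw [← Real.log_inv, inv_div]
  have h2 : x * Real.log (y / x) ≤ x * (y / x - 1) := mul_le_mul_of_nonneg_left h hx.le
  have h3 : x * (y / x - 1) = y - x := by field_simp
  rw [h1]
  linarith

theorem expFam_pos {Z : Type*} [Fintype Z] [Nonempty Z] {ν : Z → ℝ} (hν : ∀ z, 0 < ν z)
    {F : Set (Z → ℝ)} {π : Z → ℝ} (h : π ∈ expFam ν F) (z : Z) : 0 < π z := by
  obtain ⟨f, -, rfl⟩ := h
  exact div_pos (mul_pos (hν z) (Real.exp_pos _))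
    (Finset.sum_pos (fun z _ => mul_pos (hν z) (Real.exp_pos _)) Finset.univ_nonempty)

theorem expFam_sum {Z : Type*} [Fintype Z] [Nonempty Z] {ν : Z → ℝ} (hν : ∀ z, 0 < ν z)
    {F : Set (Z → ℝ)} {π : Z → ℝ} (h : π ∈ expFam ν F) : ∑ z, π z = 1 := by
  obtain ⟨f, -, rfl⟩ := h
  rw [← Finset.sum_div]
  exact div_self
    (Finset.sum_pos (fun z _ => mul_pos (hν z) (Real.exp_pos _)) Finset.univ_nonempty).ne'

theorem sum_mul_sub_log_sum_le_KL {Z : Type*} [Fintype Z] [Nonempty Z] {μ π : Z → ℝ}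
    (hμ : ∀ z, 0 < μ z) (hμ1 : ∑ z, μ z = 1) (hπ : ∀ z, 0 < π z) (g : Z → ℝ) :
    (∑ z, μ z * g z) - Real.log (∑ z, π z * Real.exp (g z)) ≤ KL μ π := by
  set S := ∑ z, π z * Real.exp (g z) with hS
  have hSpos : 0 < S :=
    Finset.sum_pos (fun z _ => mul_pos (hπ z) (Real.exp_pos _)) Finset.univ_nonempty
  have key : ∀ z, μ z - π z * Real.exp (g z) / S ≤
      μ z * Real.log (μ z / π z) - μ z * g z + μ z * Real.log S := by
    intro z
    have hp := mul_pos (hπ z) (Real.exp_pos (g z))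
    refine (sub_le_mul_log_div (hμ z) (div_pos hp hSpos)).trans_eq ?_
    rw [Real.log_div (hμ z).ne' (div_pos hp hSpos).ne', Real.log_div hp.ne' hSpos.ne',
      Real.log_mul (hπ z).ne' (Real.exp_pos _).ne', Real.log_exp,
      Real.log_div (hμ z).ne' (hπ z).ne']
    ring
  have hsum := Finset.sum_le_sum (fun z (_ : z ∈ Finset.univ) => key z)
  rw [Finset.sum_sub_distrib, ← Finset.sum_div, ← hS, div_self hSpos.ne', hμ1,
    Finset.sum_add_distrib, Finset.sum_sub_distrib, ← Finset.sum_mul, hμ1] at hsum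
  unfold KL
  linarith

theorem DmmLin_eq_KL {Z : Type*} [Fintype Z] [Nonempty Z] {d : ℕ} {ν : Z → ℝ}
    (hν : ∀ z, 0 < ν z) {ψ : Fin d → Z → ℝ} {μ π : Z → ℝ}
    (hμ : μ ∈ expFam ν {f | ∃ r : Fin d → ℝ, f = fun z => ∑ i, r i * ψ i z})
    (hπ : π ∈ expFam ν {f | ∃ r : Fin d → ℝ, f = fun z => ∑ i, r i * ψ i z}) :
    DmmLin ψ μ π = KL μ π := by
  have hμpos := expFam_pos hν hμ
  have hμ1 := expFam_sum hν hμ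
  have hπpos := expFam_pos hν hπ
  have hle := fun r : Fin d → ℝ =>
    sum_mul_sub_log_sum_le_KL hμpos hμ1 hπpos (fun z => ∑ i, r i * ψ i z)
  refine le_antisymm (ciSup_le hle) ?_
  obtain ⟨_, ⟨r, rfl⟩, hμr⟩ := hμ
  obtain ⟨_, ⟨s, rfl⟩, hπs⟩ := hπ
  refine le_ciSup_of_le ⟨_, Set.forall_mem_range.2 hle⟩ (r - s) ?_
  set S := ∑ z, ν z * Real.exp (∑ i, r i * ψ i z)
  set T := ∑ z, ν z * Real.exp (∑ i, s i * ψ i z)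
  have hS : 0 < S :=
    Finset.sum_pos (fun z _ => mul_pos (hν z) (Real.exp_pos _)) Finset.univ_nonempty
  have hT : 0 < T :=
    Finset.sum_pos (fun z _ => mul_pos (hν z) (Real.exp_pos _)) Finset.univ_nonempty
  have hg : ∀ z, ∑ i, (r - s) i * ψ i z = ∑ i, r i * ψ i z - ∑ i, s i * ψ i z := by
    intro z
    simp [sub_mul, Finset.sum_sub_distrib]
  have htilt : ∀ z, π z * Real.exp (∑ i, (r - s) i * ψ i z) = μ z * (S / T) := by
    intro z
    rw [hg, hμr, hπs, Real.exp_sub]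
    field_simp
  have hlog : ∀ z, μ z * Real.log (μ z / π z) =
      μ z * (∑ i, (r - s) i * ψ i z) - μ z * Real.log (S / T) := by
    intro z
    have h : μ z / π z = Real.exp (∑ i, (r - s) i * ψ i z) / (S / T) := by
      rw [div_eq_div_iff (hπpos z).ne' (div_pos hS hT).ne', ← htilt z, mul_comm]
    rw [h, Real.log_div (Real.exp_pos _).ne' (div_pos hS hT).ne', Real.log_exp, mul_sub]
  apply le_of_eq
  unfold KL
  simp only [hlog, htilt]
  rw [Finset.sum_sub_distrib, ← Finset.sum_mul, ← Finset.sum_mul, hμ1]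
  simp

theorem inv_card_le_iSup {Z : Type*} [Fintype Z] [Nonempty Z] {π : Z → ℝ}
    (hπ1 : ∑ z, π z = 1) : (Fintype.card Z : ℝ)⁻¹ ≤ ⨆ z, π z := by
  have hcard : (0 : ℝ) < Fintype.card Z := by exact_mod_cast Fintype.card_pos
  rw [inv_le_iff_one_le_mul₀ hcard, ← hπ1, mul_comm, ← nsmul_eq_mul]
  exact Finset.sum_le_card_nsmul _ _ _ fun z _ => le_ciSup (Set.finite_range π).bddAbove z

theorem le_of_extremal_of_notMem {Z : Type*} [Fintype Z] {π : Z → ℝ} {ε : ℝ}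
    (hπ : ∀ z, 0 ≤ π z) (hπ1 : ∑ z, π z = 1) (h : extremal ε π) {z : Z}
    (hz : z ∉ Feps ε π) : π z ≤ ε := by
  classical
  have h1 : ∑ w, ((Feps ε π).indicator π w + if w = z then π z else 0) ≤ ∑ w, π w := by
    refine Finset.sum_le_sum fun w _ => ?_
    by_cases hwz : w = z
    · subst hwz
      simp [hz]
    · simpa [hwz] using Set.indicator_le_self' (fun w _ => hπ w) w
  rw [Finset.sum_add_distrib, Finset.sum_ite_eq' Finset.univ z (fun _ => π z), hπ1] at h1
  simp only [Finset.mem_univ, if_true] at h1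
  unfold extremal at h
  linarith

theorem mul_log_sub_one_le_KL {Z : Type*} [Fintype Z] {μ π : Z → ℝ}
    (hμ : ∀ z, 0 < μ z) (hμ1 : ∑ z, μ z = 1) (hπ : ∀ z, 0 < π z) (hπ1 : ∑ z, π z = 1)
    {c ε : ℝ} (hε : 0 < ε) (hεc : ε ≤ c) {z : Z} (hz : c ≤ μ z) (hz' : π z ≤ ε) :
    c * Real.log (c / ε) - 1 ≤ KL μ π := by
  classical
  have hrest : ∑ w ∈ Finset.univ.erase z, (μ w - π w) ≤
      ∑ w ∈ Finset.univ.erase z, μ w * Real.log (μ w / π w) :=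
    Finset.sum_le_sum fun w _ => sub_le_mul_log_div (hμ w) (hπ w)
  have hsum := Finset.add_sum_erase Finset.univ (fun w => μ w - π w) (Finset.mem_univ z)
  have htotal : ∑ w, (μ w - π w) = 0 := by rw [Finset.sum_sub_distrib, hμ1, hπ1, sub_self]
  rw [htotal] at hsum
  have hμz : μ z ≤ 1 := hμ1 ▸ Finset.single_le_sum (fun w _ => (hμ w).le) (Finset.mem_univ z)
  have hc : 0 < c := hε.trans_le hεc
  have hlog : Real.log (c / ε) ≤ Real.log (μ z / π z) :=
    Real.log_le_log (div_pos hc hε) (div_le_div₀ (hμ z).le hz (hπ z) hz')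
  have hlog0 : 0 ≤ Real.log (c / ε) := Real.log_nonneg ((one_le_div hε).2 hεc)
  have hmul : c * Real.log (c / ε) ≤ μ z * Real.log (μ z / π z) :=
    mul_le_mul hz hlog hlog0 (hμ z).le
  unfold KL
  rw [← Finset.add_sum_erase Finset.univ _ (Finset.mem_univ z)]
  linarith [hπ z]

theorem mul_log_sub_one_le_KL_of_distinguishable {Z : Type*} [Fintype Z] [Nonempty Z]
    {μ π : Z → ℝ} (hμ : ∀ z, 0 < μ z) (hμ1 : ∑ z, μ z = 1) (hπ : ∀ z, 0 < π z)
    (hπ1 : ∑ z, π z = 1) {ε : ℝ} (hε : 0 < ε) (hεc : ε ≤ (Fintype.card Z : ℝ)⁻¹ / 2)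
    (hext : extremal ε π) (hdist : distinguishable ε μ π) :
    (Fintype.card Z : ℝ)⁻¹ / 2 * Real.log ((Fintype.card Z : ℝ)⁻¹ / 2 / ε) - 1 ≤ KL μ π := by
  obtain ⟨⟨z, hzμ, hzπ⟩, -⟩ := hdist
  have hmax := inv_card_le_iSup hμ1
  have hzμ' : (⨆ w, μ w) - ε ≤ μ z := hzμ
  exact mul_log_sub_one_le_KL hμ hμ1 hπ hπ1 hε hεc (by linarith)
    (le_of_extremal_of_notMem (fun w => (hπ w).le) hπ1 hext hzπ)

theorem expFam_distinguishable_implication {Z : Type*} [Fintype Z] [Nonempty Z]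
    {d : ℕ} (ν : Z → ℝ) (hν : ∀ z, 0 < ν z) (hνsum : ∑ z, ν z = 1)
    (ψ : Fin d → Z → ℝ) (hmin : LinearIndependent ℝ (Fin.cons (1 : Z → ℝ) ψ))
    (E : Set (Z → ℝ))
    (hE : E = expFam ν {f | ∃ r : Fin d → ℝ, f = fun z => ∑ i, r i * ψ i z})
    (N : ℕ) (hbdd : BddAbove {m : ℕ | distinguishProp E m})
    (hN : N = sSup {m : ℕ | distinguishProp E m}) (hN2 : 2 ≤ N) :
    ∃ A : ℕ → Finset (Z → ℝ),
      (∀ k, ↑(A k) ⊆ E ∧ (A k).card = N ∧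
        ∀ π ∈ A k, ∀ π' ∈ A k, DmmLin ψ π π' = KL π π') ∧
      Tendsto
        (fun k =>
          sInf {v : ℝ | ∃ π ∈ A k, ∃ π' ∈ A k, π ≠ π' ∧ v = DmmLin ψ π π'})
        atTop atTop := by
  subst hE
  have hNmem : distinguishProp
      (expFam ν {f | ∃ r : Fin d → ℝ, f = fun z => ∑ i, r i * ψ i z}) N := by
    rw [hN]
    refine Nat.sSup_mem ?_ hbdd
    by_contra hne
    rw [Set.not_nonempty_iff_eq_empty] at hne
    rw [hne] at hN
    simp at hN
    omega
  obtain ⟨ε₀, hε₀, hA⟩ := hNmem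
  set c : ℝ := (Fintype.card Z : ℝ)⁻¹ / 2 with hc_def
  have hc : 0 < c := by
    have : (0 : ℝ) < Fintype.card Z := by exact_mod_cast Fintype.card_pos
    positivity
  set ε : ℕ → ℝ := fun k => min ε₀ c / 2 / (k + 1) with hε_def
  have hδ : 0 < min ε₀ c / 2 := half_pos (lt_min hε₀ hc)
  have hε : ∀ k, 0 < ε k := fun k => by positivity
  have hε_le : ∀ k, ε k ≤ min ε₀ c / 2 := fun k =>
    div_le_self hδ.le (by linarith [(Nat.cast_nonneg k : (0 : ℝ) ≤ k)])
  have hA' : ∀ k, ∃ A : Finset (Z → ℝ),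
      ↑A ⊆ expFam ν {f | ∃ r : Fin d → ℝ, f = fun z => ∑ i, r i * ψ i z} ∧ A.card = N ∧
      (∀ π ∈ A, extremal (ε k) π) ∧
      ∀ π ∈ A, ∀ π' ∈ A, π ≠ π' → distinguishable (ε k) π π' := by
    intro k
    obtain ⟨B, hBE, hBN, hBext, hBdist⟩ :=
      hA (ε k) (hε k) (by linarith [hε_le k, min_le_left ε₀ c])
    obtain ⟨A, hAB, hAN⟩ := Finset.exists_subset_card_eq hBN
    exact ⟨A, fun π hπ => hBE (hAB hπ), hAN, fun π hπ => hBext π (hAB hπ),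
      fun π hπ π' hπ' => hBdist π (hAB hπ) π' (hAB hπ')⟩
  choose A hAE hAN hAext hAdist using hA'
  refine ⟨A, fun k => ⟨hAE k, hAN k, fun π hπ π' hπ' =>
    DmmLin_eq_KL hν (hAE k hπ) (hAE k hπ')⟩, ?_⟩
  have hlim : Tendsto (fun k => c * Real.log (c / ε k) - 1) atTop atTop := by
    refine tendsto_atTop_add_const_right _ _ (Tendsto.const_mul_atTop hc
      (Real.tendsto_log_atTop.comp ?_))
    have heq : (fun k => c / ε k) = fun k : ℕ => c / (min ε₀ c / 2) * ((k : ℝ) + 1) := by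
      funext k
      simp only [hε_def, div_div_eq_mul_div]
      ring
    rw [heq]
    exact Tendsto.const_mul_atTop (div_pos hc hδ)
      (tendsto_atTop_add_const_right _ _ tendsto_natCast_atTop_atTop)
  refine tendsto_atTop_mono (fun k => le_csInf ?_ ?_) hlim
  · obtain ⟨π, hπ, π', hπ', hne⟩ := Finset.one_lt_card.1 (by rw [hAN k]; omega : 1 < (A k).card)
    exact ⟨_, π, hπ, π', hπ', hne, rfl⟩
  · rintro _ ⟨π, hπ, π', hπ', hne, rfl⟩
    have hπE := hAE k hπ
    have hπE' := hAE k hπ'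
    rw [DmmLin_eq_KL hν hπE hπE']
    exact mul_log_sub_one_le_KL_of_distinguishable (expFam_pos hν hπE) (expFam_sum hν hπE)
      (expFam_pos hν hπE') (expFam_sum hν hπE') (hε k)
      (by linarith [hε_le k, min_le_right ε₀ c]) (hAext k π' hπ') (hAdist k π hπ π' hπ' hne)
end

section
/- Let Z be a finite set and let d be an integer with 1 ≤ d and d + 1 ≤ |Z|. Then N̄(d) ≤ exp( (d+1) · (1 + log|Z| − log(d+1)) ). -/
/-- `N(E)`: the maximum `N` such that `distinguishProp E N` holds. -/
noncomputable def NE {Z : Type*} [Fintype Z] (E : Set (Z → ℝ)) : ℕ :=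
  sSup {N : ℕ | distinguishProp E N}

/-- `E` is a `d`-dimensional exponential family on `Z`: `E = E(ν, F)` for some
full-support `ν ∈ P(Z)` and `F` spanned by a minimal basis `ψ₁,…,ψ_d`. -/
def IsExpFamOfDim {Z : Type*} [Fintype Z] (d : ℕ) (E : Set (Z → ℝ)) : Prop :=
  ∃ ν : Z → ℝ, (∀ z, 0 < ν z) ∧ (∑ z, ν z = 1) ∧
    ∃ ψ : Fin d → Z → ℝ, LinearIndependent ℝ (Fin.cons (1 : Z → ℝ) ψ) ∧
      E = expFam ν {f | ∃ r : Fin d → ℝ, f = fun z => ∑ i, r i * ψ i z}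

/-- `N̄(d)`: the maximum of `N(E)` over all `d`-dimensional exponential
families `E` on `Z`. -/
noncomputable def Nbar (Z : Type*) [Fintype Z] (d : ℕ) : ℕ :=
  sSup {n : ℕ | ∃ E : Set (Z → ℝ), IsExpFamOfDim d E ∧ n = NE E}

/-- Sign patterns of a finite-dimensional affine space of functions have VC dimension at most
the dimension of its direction. -/
theorem vcDim_le_finrank_of_nonneg_sets {Z : Type*} [Fintype Z] [DecidableEq Z]
    (W : Submodule ℝ (Z → ℝ)) (g : Z → ℝ) (𝒜 : Finset (Finset Z))
    (h𝒜 : ∀ s ∈ 𝒜, ∃ v ∈ W, ∀ z, z ∈ s ↔ 0 ≤ g z + v z) :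
    𝒜.vcDim ≤ Module.finrank ℝ W := by
  refine Finset.sup_le fun S hS => ?_
  rw [Finset.mem_shatterer] at hS
  by_contra! hlt
  let R : W →ₗ[ℝ] (S → ℝ) := (LinearMap.funLeft ℝ ℝ ((↑) : S → Z)).comp W.subtype
  have hR : LinearMap.range R < ⊤ := by
    refine lt_top_iff_ne_top.2 fun htop => ?_
    have h₁ := LinearMap.finrank_range_le R
    rw [htop, finrank_top, Module.finrank_fintype_fun_eq_card, Fintype.card_coe] at h₁
    omega
  obtain ⟨φ, hφ, hker⟩ := Submodule.exists_le_ker_of_lt_top _ hR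
  set c : S → ℝ := fun z => φ (Pi.single z 1) with hc
  have hφc (x : S → ℝ) : φ x = ∑ z, x z * c z := by
    rw [LinearMap.pi_apply_eq_sum_univ φ x]
    refine Finset.sum_congr rfl fun z _ => ?_
    rw [smul_eq_mul, hc]
    congr 2
    ext j
    simp [Pi.single_apply, eq_comm]
  have hv (v : Z → ℝ) (hv : v ∈ W) : ∑ z : S, (g z + v z) * c z = ∑ z : S, g z * c z := by
    have h₀ : φ (R ⟨v, hv⟩) = 0 := hker (LinearMap.mem_range_self R _)
    rw [hφc] at h₀
    have h₁ : ∑ z : S, v z * c z = 0 := h₀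
    simp only [add_mul, Finset.sum_add_distrib, h₁, add_zero]
  have key (p : S → Prop) : ∃ v ∈ W, ∀ z : S, p z ↔ 0 ≤ g z + v z := by
    classical
    let t : Finset Z := (Finset.univ.filter p).map (Function.Embedding.subtype _)
    have ht : t ⊆ S := by
      intro z hz
      obtain ⟨y, -, rfl⟩ := Finset.mem_map.1 hz
      exact y.2
    obtain ⟨u, hu, hut⟩ := hS ht
    obtain ⟨v, hvW, hvu⟩ := h𝒜 u hu
    refine ⟨v, hvW, fun z => ?_⟩
    have hzt : (z : Z) ∈ t ↔ p z := by simp [t]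
    rw [← hvu, ← hzt, ← hut, Finset.mem_inter, and_iff_right z.2]
  obtain ⟨v, hvW, hvs⟩ := key fun z => 0 ≤ c z
  obtain ⟨w, hwW, hws⟩ := key fun z => c z ≤ 0
  have hvn (z : S) : 0 ≤ (g z + v z) * c z := by
    by_cases h : 0 ≤ c z
    · exact mul_nonneg ((hvs z).1 h) h
    · have := (hvs z).not.1 h
      exact mul_nonneg_of_nonpos_of_nonpos (by linarith) (by linarith)
  have hwn (z : S) : (g z + w z) * c z ≤ 0 := by
    by_cases h : c z ≤ 0
    · exact mul_nonpos_of_nonneg_of_nonpos ((hws z).1 h) h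
    · have := (hws z).not.1 h
      exact mul_nonpos_of_nonpos_of_nonneg (by linarith) (by linarith)
  have hvsum := Finset.sum_nonneg fun z (_ : z ∈ Finset.univ) => hvn z
  have hwsum := Finset.sum_nonpos fun z (_ : z ∈ Finset.univ) => hwn z
  have hv₀ : ∑ z : S, (g z + v z) * c z = 0 := by
    linarith [hv v hvW, hv w hwW]
  have hw₀ : ∑ z : S, (g z + w z) * c z = 0 := by
    linarith [hv v hvW, hv w hwW]
  have hc₀ : ∀ z, c z = 0 := by
    intro z
    have hvz := (Finset.sum_eq_zero_iff_of_nonneg fun z _ => hvn z).1 hv₀ z (Finset.mem_univ z)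
    have hwz := (Finset.sum_eq_zero_iff_of_nonpos fun z _ => hwn z).1 hw₀ z (Finset.mem_univ z)
    by_contra hz
    have hgv := (mul_eq_zero.1 hvz).resolve_right hz
    have hgw := (mul_eq_zero.1 hwz).resolve_right hz
    exact hz (le_antisymm ((hws z).2 hgw.ge) ((hvs z).2 hgv.ge))
  refine hφ (LinearMap.ext fun x => ?_)
  simp [hφc, hc₀]

theorem sum_choose_le_exp {n k : ℕ} (hk : 0 < k) (hkn : k ≤ n) :
    ((∑ i ∈ Finset.Iic k, n.choose i : ℕ) : ℝ) ≤
      Real.exp (k * (1 + Real.log n - Real.log k)) := by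
  have hk' : (0 : ℝ) < k := by exact_mod_cast hk
  have hn' : (0 : ℝ) < n := by exact_mod_cast hk.trans_le hkn
  set q : ℝ := k / n with hq
  have hq₀ : 0 < q := by positivity
  have hq₁ : q ≤ 1 := (div_le_one hn').2 (by exact_mod_cast hkn)
  have hsum : ((∑ i ∈ Finset.Iic k, n.choose i : ℕ) : ℝ) * q ^ k ≤ Real.exp k := by
    calc ((∑ i ∈ Finset.Iic k, n.choose i : ℕ) : ℝ) * q ^ k
        = ∑ i ∈ Finset.Iic k, (n.choose i : ℝ) * q ^ k := by
          rw [Nat.cast_sum, Finset.sum_mul]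
      _ ≤ ∑ i ∈ Finset.Iic k, (n.choose i : ℝ) * q ^ i := by
          refine Finset.sum_le_sum fun i hi => ?_
          gcongr ?_ * ?_
          exact pow_le_pow_of_le_one hq₀.le hq₁ (Finset.mem_Iic.1 hi)
      _ ≤ ∑ i ∈ Finset.range (n + 1), (n.choose i : ℝ) * q ^ i := by
          refine Finset.sum_le_sum_of_subset_of_nonneg (fun i hi => ?_) fun i _ _ => by positivity
          rw [Finset.mem_Iic] at hi
          rw [Finset.mem_range]
          omega
      _ = (q + 1) ^ n := by
          rw [add_pow]
          exact Finset.sum_congr rfl fun i _ => by rw [one_pow, mul_one, mul_comm]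
      _ ≤ Real.exp q ^ n := by
          gcongr
          exact Real.add_one_le_exp q
      _ = Real.exp k := by
          rw [← Real.exp_nat_mul, hq, mul_div_cancel₀ _ hn'.ne']
  have hqk : q ^ k = Real.exp (k * (Real.log k - Real.log n)) := by
    rw [← Real.log_div hk'.ne' hn'.ne', Real.exp_nat_mul, Real.exp_log hq₀]
  rw [← le_div_iff₀ (by positivity), hqk, ← Real.exp_sub] at hsum
  exact hsum.trans_eq (congrArg Real.exp (by ring))

/-- A superlevel set of a member of an exponential family is a superlevel set of its exponent. -/
theorem exists_le_iff_nonneg_log_add {Z : Type*} [Fintype Z] [Nonempty Z] {ν : Z → ℝ}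
    (hν : ∀ z, 0 < ν z) (f : Z → ℝ) (c : ℝ) :
    ∃ t : ℝ, ∀ z, c ≤ ν z * Real.exp (f z) / ∑ z', ν z' * Real.exp (f z') ↔
      0 ≤ Real.log (ν z) + (f z - t) := by
  have hpos (z : Z) : 0 < ν z * Real.exp (f z) := mul_pos (hν z) (Real.exp_pos _)
  have hS : 0 < ∑ z', ν z' * Real.exp (f z') :=
    Finset.sum_pos (fun z _ => hpos z) Finset.univ_nonempty
  rcases lt_or_ge 0 c with hc | hc
  · refine ⟨Real.log (c * ∑ z', ν z' * Real.exp (f z')), fun z => ?_⟩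
    rw [le_div_iff₀ hS, ← Real.log_le_log_iff (mul_pos hc hS) (hpos z),
      Real.log_mul (hν z).ne' (Real.exp_pos _).ne', Real.log_exp, ← add_sub_assoc, sub_nonneg]
  · obtain ⟨t, ht⟩ := (Set.finite_range fun z => Real.log (ν z) + f z).bddBelow
    refine ⟨t, fun z => iff_of_true (hc.trans (div_pos (hpos z) hS).le) ?_⟩
    have := ht (Set.mem_range_self z)
    linarith

theorem le_sum_choose_of_distinguishProp {Z : Type*} [Fintype Z] [Nonempty Z] {d : ℕ}
    {E : Set (Z → ℝ)} (hE : IsExpFamOfDim d E) {N : ℕ} (hN : distinguishProp E N) :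
    N ≤ ∑ i ∈ Finset.Iic (d + 1), (Fintype.card Z).choose i := by
  classical
  obtain ⟨ν, hν, -, ψ, -, rfl⟩ := hE
  obtain ⟨ε₀, hε₀, h⟩ := hN
  obtain ⟨A, hAE, hNA, -, hA⟩ := h (ε₀ / 2) (by linarith) (by linarith)
  set b : Fin (d + 1) → Z → ℝ := Fin.cons (1 : Z → ℝ) ψ with hb
  set W := Submodule.span ℝ (Set.range b) with hW
  let 𝒜 : Finset (Finset Z) := A.image fun π => (Feps (ε₀ / 2) π).toFinset
  have hcard : 𝒜.card = A.card := by
    refine Finset.card_image_of_injOn fun π hπ π' hπ' heq => ?_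
    by_contra hne
    obtain ⟨z, hz⟩ := (hA π hπ π' hπ' hne).1
    rw [Set.toFinset_inj.1 heq, Set.sdiff_self] at hz
    exact hz
  have hvc : 𝒜.vcDim ≤ d + 1 := by
    refine (vcDim_le_finrank_of_nonneg_sets W (fun z => Real.log (ν z)) 𝒜 ?_).trans
      ((finrank_range_le_card b).trans (Fintype.card_fin _).le)
    intro s hs
    obtain ⟨π, hπ, rfl⟩ := Finset.mem_image.1 hs
    obtain ⟨f, ⟨r, hr⟩, hf⟩ := hAE hπ
    obtain ⟨t, ht⟩ := exists_le_iff_nonneg_log_add hν f ((⨆ z, π z) - ε₀ / 2)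
    have hfW : f ∈ W := by
      have : f = ∑ i, r i • ψ i := by
        ext z
        simp [hr]
      rw [this]
      exact W.sum_mem fun i _ => W.smul_mem _ (Submodule.subset_span ⟨i.succ, by simp [hb]⟩)
    have h1W : (1 : Z → ℝ) ∈ W := Submodule.subset_span ⟨0, by simp [hb]⟩
    refine ⟨f - t • (1 : Z → ℝ), W.sub_mem hfW (W.smul_mem _ h1W), fun z => ?_⟩
    rw [Set.mem_toFinset, Feps, Set.mem_ofPred_eq]
    simpa [← congrFun hf z] using ht z
  calc N ≤ 𝒜.card := hNA.trans hcard.ge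
    _ ≤ 𝒜.shatterer.card := Finset.card_le_card_shatterer 𝒜
    _ ≤ ∑ i ∈ Finset.Iic 𝒜.vcDim, (Fintype.card Z).choose i :=
        Finset.card_shatterer_le_sum_vcDim
    _ ≤ ∑ i ∈ Finset.Iic (d + 1), (Fintype.card Z).choose i :=
        Finset.sum_le_sum_of_subset (Finset.Iic_subset_Iic.2 hvc)

theorem Nbar_upper_bound_exp {Z : Type*} [Fintype Z] [Nonempty Z] (d : ℕ)
    (hd : 1 ≤ d) (hdZ : d + 1 ≤ Fintype.card Z) :
    (Nbar Z d : ℝ) ≤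
      Real.exp (((d : ℝ) + 1) *
        (1 + Real.log (Fintype.card Z) - Real.log ((d : ℝ) + 1))) := by
  have hle : Nbar Z d ≤ ∑ i ∈ Finset.Iic (d + 1), (Fintype.card Z).choose i := by
    refine csSup_le' ?_
    rintro _ ⟨E, hE, rfl⟩
    exact csSup_le' fun N hN => le_sum_choose_of_distinguishProp hE hN
  have h := (Nat.cast_le (α := ℝ).2 hle).trans (sum_choose_le_exp d.succ_pos hdZ)
  exact_mod_cast h
end

section
/- Let Z be a finite set with |Z| ≥ 3. Then N̄(2) ≥ |Z|. -/
theorem Feps_injOn_of_distinguishable {Z : Type*} [Fintype Z] {ε : ℝ} {A : Set (Z → ℝ)}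
    (hA : ∀ π ∈ A, ∀ π' ∈ A, π ≠ π' → distinguishable ε π π') : Set.InjOn (Feps ε) A := by
  intro x hx y hy hxy
  by_contra hne
  obtain ⟨⟨z, hz, hz'⟩, -⟩ := hA x hx y hy hne
  exact hz' (hxy ▸ hz)

theorem distinguishProp_le_card_set {Z : Type*} [Fintype Z] {E : Set (Z → ℝ)} {N : ℕ}
    (h : distinguishProp E N) : N ≤ Nat.card (Set Z) := by
  obtain ⟨ε₀, h₀, h⟩ := h
  obtain ⟨A, -, hN, -, hd⟩ := h (ε₀ / 2) (by linarith) (by linarith)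
  have hinj : Set.InjOn (Feps (ε₀ / 2)) (A : Set (Z → ℝ)) :=
    Feps_injOn_of_distinguishable hd
  calc N ≤ A.card := hN
    _ = (A : Set (Z → ℝ)).ncard := (Set.ncard_coe_finset A).symm
    _ = (Feps (ε₀ / 2) '' (A : Set (Z → ℝ))).ncard := hinj.ncard_image.symm
    _ ≤ Nat.card (Set Z) := Set.ncard_le_card _

theorem le_NE_of_distinguishProp {Z : Type*} [Fintype Z] {E : Set (Z → ℝ)} {N : ℕ}
    (h : distinguishProp E N) : N ≤ NE E :=
  le_csSup ⟨Nat.card (Set Z), fun _ => distinguishProp_le_card_set⟩ h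

theorem NE_le_card_set {Z : Type*} [Fintype Z] (E : Set (Z → ℝ)) : NE E ≤ Nat.card (Set Z) :=
  csSup_le' fun _ => distinguishProp_le_card_set

theorem NE_le_Nbar {Z : Type*} [Fintype Z] {d : ℕ} {E : Set (Z → ℝ)} (hE : IsExpFamOfDim d E) :
    NE E ≤ Nbar Z d := by
  refine le_csSup ⟨Nat.card (Set Z), ?_⟩ ⟨E, hE, rfl⟩
  rintro _ ⟨E', -, rfl⟩
  exact NE_le_card_set E'

/-- A distribution with an atom of mass more than `1 - ε` has that atom as its only
`ε`-approximate mode. -/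
theorem Feps_eq_singleton {Z : Type*} [Fintype Z] {ε : ℝ} {x : Z → ℝ} {k : Z} (hε : 0 < ε)
    (hε' : ε < 1 / 3) (hk : 1 - ε < x k) (hx : ∀ z ≠ k, x z < ε) : Feps ε x = {k} := by
  have : Nonempty Z := ⟨k⟩
  have hsup : ⨆ z, x z = x k := by
    refine le_antisymm (ciSup_le fun z => ?_) (le_ciSup (Set.finite_range x).bddAbove k)
    by_cases hz : z = k
    · rw [hz]
    · linarith [hx z hz]
  ext z
  simp only [Feps, hsup, Set.mem_ofPred_eq, Set.mem_singleton_iff]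
  refine ⟨fun h => ?_, fun h => ?_⟩
  · by_contra hz
    linarith [hx z hz]
  · rw [h]
    linarith

/-- If members of `E` concentrate arbitrarily well on every point of `Z`, then `N(E) ≥ |Z|`. -/
theorem distinguishProp_card_of_concentrates {Z : Type*} [Fintype Z] {E : Set (Z → ℝ)}
    (hE : ∀ ε > (0 : ℝ), ∀ k, ∃ x ∈ E, 1 - ε < x k ∧ ∀ z ≠ k, x z < ε) :
    distinguishProp E (Fintype.card Z) := by
  classical
  refine ⟨1 / 3, by norm_num, fun ε hε hε' => ?_⟩
  choose x hxE hxk hx using hE ε hε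
  have hF : ∀ k, Feps ε (x k) = {k} := fun k => Feps_eq_singleton hε hε' (hxk k) (hx k)
  have hinj : Function.Injective x := fun k l h =>
    Set.singleton_injective (by rw [← hF k, ← hF l, h])
  refine ⟨Finset.univ.image x, ?_, ?_, ?_, ?_⟩
  · intro y hy
    obtain ⟨k, -, rfl⟩ := Finset.mem_image.1 hy
    exact hxE k
  · rw [Finset.card_image_of_injective _ hinj, Finset.card_univ]
  · intro y hy
    obtain ⟨k, -, rfl⟩ := Finset.mem_image.1 hy
    rw [extremal, hF k]
    simpa [Set.indicator_apply] using (hxk k).le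
  · intro y hy y' hy' hne
    obtain ⟨k, -, rfl⟩ := Finset.mem_image.1 hy
    obtain ⟨l, -, rfl⟩ := Finset.mem_image.1 hy'
    have hkl : k ≠ l := fun h => hne (h ▸ rfl)
    rw [distinguishable, hF k, hF l]
    exact ⟨⟨k, rfl, hkl⟩, ⟨l, rfl, hkl.symm⟩⟩

/-- `a` and `a ^ 2` form a minimal basis once `a` takes the values `0`, `1` and `2`. -/
theorem linearIndependent_one_id_sq {Z : Type*} {a : Z → ℝ} {z₀ z₁ z₂ : Z} (h₀ : a z₀ = 0)
    (h₁ : a z₁ = 1) (h₂ : a z₂ = 2) :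
    LinearIndependent ℝ (Fin.cons (1 : Z → ℝ) ![a, fun z => a z ^ 2] : Fin 3 → Z → ℝ) := by
  rw [Fintype.linearIndependent_iff]
  intro g hg
  have key : ∀ z, g 0 + g 1 * a z + g 2 * a z ^ 2 = 0 := fun z => by
    have h := congrFun hg z
    rw [Fin.sum_univ_three] at h
    change g 0 * 1 + g 1 * a z + g 2 * a z ^ 2 = 0 at h
    rwa [mul_one] at h
  have e₀ := key z₀
  have e₁ := key z₁
  have e₂ := key z₂
  rw [h₀] at e₀
  rw [h₁] at e₁
  rw [h₂] at e₂
  intro i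
  fin_cases i
  · change g 0 = 0
    linarith
  · change g 1 = 0
    linarith
  · change g 2 = 0
    linarith

/-- The discrete Gaussian family spanned by `a` and `a ^ 2` concentrates on each point when the
values of `a` are at distance at least one from each other. -/
theorem expFam_concentrates {Z : Type*} [Fintype Z] {a : Z → ℝ} {c : ℝ} (hc : 0 < c)
    (ha : ∀ z w, z ≠ w → 1 ≤ (a z - a w) ^ 2) {ε : ℝ} (hε : 0 < ε) (k : Z) :
    ∃ x ∈ expFam (fun _ => c)
        {f | ∃ r : Fin 2 → ℝ, f = fun z => ∑ i, r i * (![a, fun z => a z ^ 2] i : Z → ℝ) z},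
      1 - ε < x k ∧ ∀ z ≠ k, x z < ε := by
  classical
  have : Nonempty Z := ⟨k⟩
  obtain ⟨s, hs₀, hs⟩ : ∃ s : ℝ, 0 ≤ s ∧ Fintype.card Z * Real.exp (-s) < ε := by
    have ht : Filter.Tendsto (fun s : ℝ => Fintype.card Z * Real.exp (-s)) Filter.atTop
        (nhds 0) := by
      simpa using Real.tendsto_exp_neg_atTop_nhds_zero.const_mul (Fintype.card Z : ℝ)
    exact ((Filter.eventually_ge_atTop 0).and (ht.eventually_lt_const hε)).exists
  set f : Z → ℝ := fun z => ∑ i, ![2 * s * a k, -s] i * (![a, fun z => a z ^ 2] i : Z → ℝ) z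
    with hf
  set S : ℝ := ∑ z, c * Real.exp (f z) with hS
  have hfz : ∀ z, f z = f k - s * (a z - a k) ^ 2 := fun z => by
    simp only [hf, Fin.sum_univ_two, Matrix.cons_val_zero, Matrix.cons_val_one]
    ring
  have hSk : c * Real.exp (f k) ≤ S :=
    Finset.single_le_sum (f := fun z => c * Real.exp (f z)) (fun z _ => by positivity)
      (Finset.mem_univ k)
  have hSpos : 0 < S := lt_of_lt_of_le (by positivity) hSk
  have hz : ∀ z ≠ k, c * Real.exp (f z) / S ≤ Real.exp (-s) := fun z hzk => by
    rw [div_le_iff₀ hSpos]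
    calc c * Real.exp (f z) ≤ c * Real.exp (-s + f k) := by
          gcongr
          rw [hfz z]
          nlinarith [ha z k hzk]
      _ = Real.exp (-s) * (c * Real.exp (f k)) := by
          rw [Real.exp_add]
          ring
      _ ≤ Real.exp (-s) * S := by gcongr
  have hsum : ∑ z, c * Real.exp (f z) / S = 1 := by
    rw [← Finset.sum_div, div_self hSpos.ne']
  have hcard : (1 : ℝ) ≤ Fintype.card Z := by exact_mod_cast Fintype.card_pos
  refine ⟨fun z => c * Real.exp (f z) / S, ⟨f, ⟨_, hf⟩, rfl⟩, ?_, fun z hzk => ?_⟩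
  · have hrest : ∑ z ∈ Finset.univ.erase k, c * Real.exp (f z) / S ≤
        Fintype.card Z * Real.exp (-s) := by
      calc _ ≤ (Finset.univ.erase k).card • Real.exp (-s) :=
            Finset.sum_le_card_nsmul _ _ _ fun z h => hz z (Finset.ne_of_mem_erase h)
        _ ≤ Fintype.card Z * Real.exp (-s) := by
            rw [nsmul_eq_mul]
            gcongr
            exact Finset.card_le_univ _
    have := Finset.add_sum_erase Finset.univ (fun z => c * Real.exp (f z) / S)
      (Finset.mem_univ k)
    simp only [hsum] at this
    linarith
  · have := hz z hzk
    nlinarith [Real.exp_pos (-s)]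

theorem Nbar_two_ge_card {Z : Type*} [Fintype Z] (hZ : 3 ≤ Fintype.card Z) :
    Fintype.card Z ≤ Nbar Z 2 := by
  let e := Fintype.equivFin Z
  let a : Z → ℝ := fun z => ((e z : ℕ) : ℝ)
  have ha : ∀ z w, z ≠ w → 1 ≤ (a z - a w) ^ 2 := fun z w hzw => by
    have h : ((e z : ℕ) : ℤ) - ((e w : ℕ) : ℤ) ≠ 0 := fun h =>
      hzw (e.injective (Fin.ext (by omega)))
    have h' : (1 : ℤ) ≤ (((e z : ℕ) : ℤ) - ((e w : ℕ) : ℤ)) ^ 2 :=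
      Int.add_one_le_iff.2 (sq_pos_of_ne_zero h)
    have h'' : (1 : ℝ) ≤ ((((e z : ℕ) : ℤ) - ((e w : ℕ) : ℤ)) ^ 2 : ℤ) := by exact_mod_cast h'
    simpa [a] using h''
  have hc : (0 : ℝ) < (Fintype.card Z : ℝ)⁻¹ := by
    have : 0 < Fintype.card Z := by omega
    positivity
  refine le_trans (le_NE_of_distinguishProp (distinguishProp_card_of_concentrates
    fun ε hε k => expFam_concentrates hc ha hε k)) (NE_le_Nbar ?_)
  refine ⟨_, fun _ => hc, ?_, ![a, fun z => a z ^ 2], ?_, rfl⟩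
  · rw [Finset.sum_const, Finset.card_univ, nsmul_eq_mul, mul_inv_cancel₀ (inv_pos.1 hc).ne']
  · exact linearIndependent_one_id_sq (z₀ := e.symm ⟨0, by omega⟩) (z₁ := e.symm ⟨1, by omega⟩)
      (z₂ := e.symm ⟨2, by omega⟩) (by simp [a]) (by simp [a]) (by simp [a])
end

section
/- Let X̄ be a p×n real matrix with rank(X̄) = d, let S = {X ∈ ℝ^{p×n} : rank(X) ≤ d}, and let H = {X̄W₁ + W₂X̄ : W₁ ∈ ℝ^{n×n}, W₂ ∈ ℝ^{p×p}}. Then there exist δ > 0 and M > 0 such that: (1) for any X ∈ S with ‖X − X̄‖ ≤ δ there exists Z ∈ H with ‖Z − X‖ ≤ M‖X − X̄‖²; and (2) for any Z ∈ H with ‖Z − X̄‖ ≤ δ there exists X ∈ S with ‖X − Z‖ ≤ M‖Z − X̄‖². -/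
/-!
STATEMENT 14: Local approximation of the rank variety by a linear space.

`fnorm` is the Frobenius norm. `S = {X : rank X ≤ d}` and
`H = {X̄W₁ + W₂X̄}`. For `X̄` of rank `d` there are `δ, M > 0` such that
(1) every `X ∈ S` within `δ` of `X̄` is within `M‖X − X̄‖²` of some `Z ∈ H`,
and (2) every `Z ∈ H` within `δ` of `X̄` is within `M‖Z − X̄‖²` of some
`X ∈ S`.
-/

noncomputable def fnorm {m n : Type*} [Fintype m] [Fintype n]
    (A : Matrix m n ℝ) : ℝ :=
  Real.sqrt (∑ i, ∑ j, A i j ^ 2)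

attribute [local instance] Matrix.frobeniusNormedAddCommGroup Matrix.frobeniusNormedSpace
  Matrix.frobeniusNormedRing

theorem fnorm_eq_norm {m n : Type*} [Fintype m] [Fintype n] (A : Matrix m n ℝ) :
    fnorm A = ‖A‖ := by
  rw [Matrix.frobenius_norm_def, fnorm, Real.sqrt_eq_rpow]
  simp

namespace Matrix

/-- Every matrix over a field has a reflexive generalized inverse. -/
theorem exists_generalizedInverse {m n K : Type*} [Fintype m] [Fintype n] [DecidableEq m]
    [DecidableEq n] [Field K] (A : Matrix m n K) :
    ∃ G : Matrix n m K, A * G * A = A ∧ G * A * G = G := by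
  obtain ⟨g, hg⟩ := LinearMap.exists_rightInverse_of_surjective (toLin' A).rangeRestrict
    (LinearMap.range_rangeRestrict _)
  obtain ⟨h, hh⟩ := LinearMap.exists_extend g
  have key : A * LinearMap.toMatrix' h * A = A := by
    apply toLin'.injective
    rw [toLin'_mul, toLin'_mul, toLin'_toMatrix']
    refine LinearMap.ext fun v => ?_
    have h1 : h (toLin' A v) = g ((toLin' A).rangeRestrict v) := by rw [← hh]; rfl
    have h2 := congrArg Subtype.val (LinearMap.congr_fun hg ((toLin' A).rangeRestrict v))
    simp only [LinearMap.comp_apply, h1]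
    exact h2
  refine ⟨LinearMap.toMatrix' h * A * LinearMap.toMatrix' h, ?_, ?_⟩
  · simp only [← Matrix.mul_assoc, key]
  · generalize LinearMap.toMatrix' h = B at key ⊢
    calc B * A * B * A * (B * A * B) = B * (A * B * A * B * A) * B := by
          simp only [Matrix.mul_assoc]
      _ = B * A * B := by rw [key, key]

/-- If left multiplication by `G` does not lower the rank of `X`, then it does not enlarge the
right annihilator of `X`. -/
theorem mul_eq_zero_of_rank_le {k l m n K : Type*} [Fintype k] [Fintype l] [Fintype m]
    [Fintype n] [DecidableEq k] [Field K]
    {G : Matrix l m K} {X : Matrix m n K} (h : X.rank ≤ (G * X).rank) {Y : Matrix n k K}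
    (hY : G * X * Y = 0) : X * Y = 0 := by
  have hle : LinearMap.ker X.mulVecLin ≤ LinearMap.ker (G * X).mulVecLin := by
    intro v hv
    simp only [LinearMap.mem_ker, mulVecLin_apply] at hv ⊢
    rw [← mulVec_mulVec, hv, mulVec_zero]
  have h1 := LinearMap.finrank_range_add_finrank_ker X.mulVecLin
  have h2 := LinearMap.finrank_range_add_finrank_ker (G * X).mulVecLin
  have heq := Submodule.eq_of_le_of_finrank_le hle (by unfold rank at h; omega)
  apply ext_of_mulVec_single
  intro j
  have hv : Y *ᵥ Pi.single j 1 ∈ LinearMap.ker (G * X).mulVecLin := by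
    simp only [LinearMap.mem_ker, mulVecLin_apply, mulVec_mulVec, hY, zero_mulVec]
  rw [← heq] at hv
  simpa only [LinearMap.mem_ker, mulVecLin_apply, mulVec_mulVec, zero_mulVec] using hv

/-- The exact second-order expression for the normal component of a perturbation that does not
increase the rank. -/
theorem normal_component_eq {m n K : Type*} [Fintype m] [Fintype n] [DecidableEq m]
    [DecidableEq n] [Field K] {A X : Matrix m n K} {G : Matrix n m K}
    (hA : A * G * A = A) (hG : G * A * G = G) (hX : X.rank ≤ A.rank)
    {N : Matrix n n K} (hN : N * (1 + G * (X - A)) = 1) :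
    (1 - A * G) * (X - A) * (1 - G * A) =
      (1 - A * G) * (X - A) * N * (G * (X - A)) * (1 - G * A) := by
  have hN' : (1 + G * (X - A)) * N = 1 := mul_eq_one_comm.mp hN
  have hGX : G * X * N = G * A := by
    have : G * X = G * A * (1 + G * (X - A)) := by
      rw [Matrix.mul_add, ← Matrix.mul_assoc, hG, Matrix.mul_sub]; simp
    rw [this, Matrix.mul_assoc, hN', Matrix.mul_one]
  have hrank : X.rank ≤ (G * X).rank := by
    calc X.rank ≤ A.rank := hX
      _ = (A * (G * X * N)).rank := by rw [hGX, ← Matrix.mul_assoc, hA]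
      _ ≤ (G * X * N).rank := rank_mul_le_right _ _
      _ ≤ (G * X).rank := rank_mul_le_left _ _
  have hz : X * (N * (1 - G * A)) = 0 := by
    apply mul_eq_zero_of_rank_le hrank
    rw [← Matrix.mul_assoc, hGX, Matrix.mul_sub, ← Matrix.mul_assoc, hG]; simp
  have hPX : (1 - A * G) * X = (1 - A * G) * (X - A) := by
    rw [Matrix.mul_sub _ X A, Matrix.sub_mul 1 _ A, hA]; simp
  have hN2 : N = 1 - N * (G * (X - A)) := by
    rw [Matrix.mul_add, Matrix.mul_one] at hN
    exact eq_sub_of_add_eq hN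
  have h0 : (1 - A * G) * (X - A) * N * (1 - G * A) = 0 := by
    rw [← hPX, Matrix.mul_assoc, Matrix.mul_assoc, hz, Matrix.mul_zero]
  have h1 : (1 - A * G) * (X - A) * N * (1 - G * A) =
      (1 - A * G) * (X - A) * (1 - N * (G * (X - A))) * (1 - G * A) := by rw [← hN2]
  rw [h0, Matrix.mul_sub _ _ (N * _), Matrix.mul_one, Matrix.sub_mul _ _ (1 - G * A)] at h1
  rw [sub_eq_zero.mp h1.symm]
  simp only [Matrix.mul_assoc]

/-- A matrix of norm at most `1 / 2` perturbs the identity to an invertible matrix whose inverse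
has controlled norm. -/
theorem exists_leftInverse_one_add {n : Type*} [Fintype n] [DecidableEq n] {B : Matrix n n ℝ} (hB : ‖B‖ ≤ 1 / 2) :
    ∃ N : Matrix n n ℝ, N * (1 + B) = 1 ∧ ‖N‖ ≤ 2 * ‖(1 : Matrix n n ℝ)‖ := by
  have : CompleteSpace (Matrix n n ℝ) := FiniteDimensional.complete ℝ _
  have hu : IsUnit (1 - -B) := isUnit_one_sub_of_norm_lt_one (by rw [norm_neg]; linarith)
  rw [sub_neg_eq_add] at hu
  obtain ⟨N, hN⟩ := hu.exists_left_inv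
  refine ⟨N, hN, ?_⟩
  have hN2 : N = 1 - N * B := by
    rw [Matrix.mul_add, Matrix.mul_one] at hN
    exact eq_sub_of_add_eq hN
  have h1 : ‖N‖ ≤ ‖(1 : Matrix n n ℝ)‖ + ‖N * B‖ := by
    conv_lhs => rw [hN2]
    exact norm_sub_le _ _
  have h2 : ‖N * B‖ ≤ ‖N‖ * ‖B‖ := norm_mul_le _ _
  nlinarith [norm_nonneg N]

end Matrix

theorem rank_variety_linear_approx {p n d : ℕ}
    (Xbar : Matrix (Fin p) (Fin n) ℝ) (hrank : Xbar.rank = d) :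
    ∃ δ > (0 : ℝ), ∃ M > (0 : ℝ),
      (∀ X : Matrix (Fin p) (Fin n) ℝ, X.rank ≤ d → fnorm (X - Xbar) ≤ δ →
        ∃ Zm : Matrix (Fin p) (Fin n) ℝ,
          (∃ (W₁ : Matrix (Fin n) (Fin n) ℝ) (W₂ : Matrix (Fin p) (Fin p) ℝ),
            Zm = Xbar * W₁ + W₂ * Xbar) ∧
          fnorm (Zm - X) ≤ M * fnorm (X - Xbar) ^ 2) ∧
      (∀ Zm : Matrix (Fin p) (Fin n) ℝ,
        (∃ (W₁ : Matrix (Fin n) (Fin n) ℝ) (W₂ : Matrix (Fin p) (Fin p) ℝ),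
          Zm = Xbar * W₁ + W₂ * Xbar) →
        fnorm (Zm - Xbar) ≤ δ →
        ∃ X : Matrix (Fin p) (Fin n) ℝ, X.rank ≤ d ∧
          fnorm (X - Zm) ≤ M * fnorm (Zm - Xbar) ^ 2) := by
  classical
  obtain ⟨G, hA, hG⟩ := Xbar.exists_generalizedInverse
  have hmul : ∀ {a b c : ℕ} (B : Matrix (Fin a) (Fin b) ℝ) (C : Matrix (Fin b) (Fin c) ℝ),
      ‖B * C‖ ≤ ‖B‖ * ‖C‖ := fun B C => Matrix.frobenius_norm_mul B C
  subst hrank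
  simp only [fnorm_eq_norm]
  set R : Matrix (Fin p) (Fin p) ℝ := 1 - Xbar * G with hR
  set T : Matrix (Fin n) (Fin n) ℝ := 1 - G * Xbar with hT
  set c : ℝ := 2 * ‖(1 : Matrix (Fin n) (Fin n) ℝ)‖
  set M₁ : ℝ := ‖R‖ * c * ‖G‖ * ‖T‖
  set M₂ : ℝ := ‖R‖ * ‖G‖ * ‖Xbar‖ * ‖G‖
  have hM₁ : 0 ≤ M₁ := by positivity
  have hM₂ : 0 ≤ M₂ := by positivity
  refine ⟨1 / (2 * (‖G‖ + 1)), by positivity, M₁ + M₂ + 1, by positivity, ?_, ?_⟩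
  · intro X hX hδ
    have hB : ‖G * (X - Xbar)‖ ≤ 1 / 2 := by
      have h1 := hmul G (X - Xbar)
      rw [le_div_iff₀ (by positivity)] at hδ
      nlinarith [norm_nonneg G, norm_nonneg (X - Xbar)]
    obtain ⟨N, hN, hNc⟩ := Matrix.exists_leftInverse_one_add hB
    have key := Matrix.normal_component_eq hA hG hX hN
    rw [← hR, ← hT] at key
    refine ⟨X - R * (X - Xbar) * T, ⟨1 + G * (X - Xbar), R * (X - Xbar) * G, ?_⟩, ?_⟩
    · rw [hR, hT]
      simp only [Matrix.mul_sub, Matrix.sub_mul, Matrix.mul_add, Matrix.mul_one, Matrix.one_mul,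
        ← Matrix.mul_assoc]
      abel
    · have h1 : ‖X - R * (X - Xbar) * T - X‖ = ‖R * (X - Xbar) * N * (G * (X - Xbar)) * T‖ := by
        rw [← key, sub_sub_cancel_left, norm_neg]
      calc _ = ‖R * (X - Xbar) * N * (G * (X - Xbar)) * T‖ := h1
        _ ≤ ‖R‖ * ‖X - Xbar‖ * ‖N‖ * (‖G‖ * ‖X - Xbar‖) * ‖T‖ := by
          refine (hmul _ _).trans ?_
          gcongr
          refine (hmul _ _).trans ?_
          gcongr
          · refine (hmul _ _).trans ?_
            gcongr
            exact hmul _ _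
          · exact hmul _ _
        _ ≤ ‖R‖ * ‖X - Xbar‖ * c * (‖G‖ * ‖X - Xbar‖) * ‖T‖ := by gcongr
        _ = M₁ * ‖X - Xbar‖ ^ 2 := by ring
        _ ≤ (M₁ + M₂ + 1) * ‖X - Xbar‖ ^ 2 := by gcongr; linarith
  · rintro Z ⟨W₁, W₂, hZ⟩ -
    set D := Z - Xbar with hD
    have hRX : R * Xbar = 0 := by rw [hR, Matrix.sub_mul, hA, Matrix.one_mul, sub_self]
    have hXT : Xbar * T = 0 := by
      rw [hT, Matrix.mul_sub, ← Matrix.mul_assoc, hA, Matrix.mul_one, sub_self]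
    have hnormal : R * D * T = 0 := by
      rw [hD, hZ, Matrix.mul_sub R, Matrix.mul_add R, hRX, ← Matrix.mul_assoc, hRX, Matrix.zero_mul,
        zero_add, sub_zero, Matrix.mul_assoc, Matrix.mul_assoc, hXT, Matrix.mul_zero,
        Matrix.mul_zero]
    have hdecomp : D = Xbar * (G * D) + R * D * G * Xbar := by
      have h1 : R * D = R * D * G * Xbar := by
        rw [hT, Matrix.mul_sub, Matrix.mul_one, sub_eq_zero, ← Matrix.mul_assoc] at hnormal
        exact hnormal
      rw [← h1, hR, Matrix.sub_mul, Matrix.one_mul, Matrix.mul_assoc, add_sub_cancel]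
    refine ⟨(1 + R * D * G) * (Xbar * (1 + G * D)), ?_, ?_⟩
    · exact (Matrix.rank_mul_le_right _ _).trans (Matrix.rank_mul_le_left _ _)
    · have h1 : (1 + R * D * G) * (Xbar * (1 + G * D)) - Z = R * D * G * (Xbar * (G * D)) := by
        have h2 : Z = Xbar + (Xbar * (G * D) + R * D * G * Xbar) := by
          rw [← hdecomp, hD, add_sub_cancel]
        rw [h2, Matrix.add_mul, Matrix.one_mul, Matrix.mul_add Xbar, Matrix.mul_one,
          Matrix.mul_add (R * D * G)]
        abel
      rw [h1]
      calc _ ≤ ‖R‖ * ‖D‖ * ‖G‖ * (‖Xbar‖ * (‖G‖ * ‖D‖)) := by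
            refine (hmul _ _).trans ?_
            gcongr
            · refine (hmul _ _).trans ?_
              gcongr
              exact hmul _ _
            · refine (hmul _ _).trans ?_
              gcongr
              exact hmul _ _
        _ = M₂ * ‖D‖ ^ 2 := by ring
        _ ≤ (M₁ + M₂ + 1) * ‖D‖ ^ 2 := by gcongr; linarith
end

section
/- Let Z be a finite set, let π⁰, π¹, …, π^p ∈ P(Z) with π⁰ of full support, and let γ₁,…,γ_p > 0. Define h on p×|Z| real matrices by h(X) = (1/p) Σ_{i=1}^p γ_i (⟨πⁱ, X_i⟩ − log⟨π⁰, e^{X_i}⟩), where X_i is the i-th row of X viewed as a function on Z. Then h is differentiable and its gradient ∇h (with respect to the Frobenius inner product) is Lipschitz with constant L = (1/p)·max_i γ_i: for all p×|Z| real matrices X₁, X₂, ‖∇h(X₁) − ∇h(X₂)‖ ≤ L‖X₁ − X₂‖. -/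
/-!
STATEMENT 16: Differentiability and Lipschitz continuity of the gradient.

`fnorm` is the Frobenius norm, `hobj` the objective
`h(X) = (1/p) Σᵢ γᵢ(⟨πⁱ,Xᵢ⟩ − log⟨π⁰,e^{Xᵢ}⟩)`, and `gradh` its gradient
with respect to the Frobenius inner product (as given explicitly in the
paper). The theorem asserts: `h` is differentiable; `gradh` is indeed the
gradient of `h` (its pairing with `V` is the derivative of `h` along every
line `t ↦ X + tV`); and `gradh` is Lipschitz with constant
`L = (1/p)·maxᵢ γᵢ` in the Frobenius norm.
-/

attribute [local instance] Matrix.normedAddCommGroup Matrix.normedSpace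

noncomputable def hobj {Z : Type*} [Fintype Z] {p : ℕ} (π0 : Z → ℝ)
    (πs : Fin p → Z → ℝ) (γ : Fin p → ℝ) (X : Matrix (Fin p) Z ℝ) : ℝ :=
  (1 / (p : ℝ)) * ∑ i, γ i *
    ((∑ z, πs i z * X i z) - Real.log (∑ z, π0 z * Real.exp (X i z)))

noncomputable def gradh {Z : Type*} [Fintype Z] {p : ℕ} (π0 : Z → ℝ)
    (πs : Fin p → Z → ℝ) (γ : Fin p → ℝ) (X : Matrix (Fin p) Z ℝ) :
    Matrix (Fin p) Z ℝ :=
  Matrix.of fun i z =>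
    (γ i / (p : ℝ)) *
      (πs i z - π0 z * Real.exp (X i z) / ∑ z', π0 z' * Real.exp (X i z'))

theorem weightedExpSum_pos {Z : Type*} [Fintype Z] [Nonempty Z] {w : Z → ℝ}
    (hw : ∀ z, 0 < w z) (x : Z → ℝ) : 0 < ∑ z, w z * Real.exp (x z) :=
  Finset.sum_pos (fun z _ => mul_pos (hw z) (Real.exp_pos _)) Finset.univ_nonempty

theorem hasDerivAt_weightedExpSum {Z : Type*} [Fintype Z] (w x v : Z → ℝ) (t : ℝ) :
    HasDerivAt (fun t : ℝ => ∑ z, w z * Real.exp (x z + t * v z))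
      (∑ z, w z * Real.exp (x z + t * v z) * v z) t := by
  refine HasDerivAt.fun_sum fun z _ => ?_
  have h := ((((hasDerivAt_id t).mul_const (v z)).const_add (x z)).exp).const_mul (w z)
  simpa [mul_assoc] using h

/-- For a probability vector `s`, twice the covariance of `d` and `v` is at most the sum of their
squared Euclidean norms. -/
theorem two_mul_covariance_le {Z : Type*} [Fintype Z] {s : Z → ℝ} (hs : ∀ z, 0 ≤ s z)
    (hsum : ∑ z, s z = 1) (d v : Z → ℝ) :
    2 * (∑ z, s z * d z * v z - (∑ z, s z * d z) * ∑ z, s z * v z) ≤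
      ∑ z, d z ^ 2 + ∑ z, v z ^ 2 := by
  have hle (z : Z) : s z ≤ 1 := hsum ▸ Finset.single_le_sum (fun i _ => hs i) (Finset.mem_univ z)
  have hsq (u : Z → ℝ) : ∑ z, s z * u z ^ 2 ≤ ∑ z, u z ^ 2 :=
    Finset.sum_le_sum fun z _ => mul_le_of_le_one_left (sq_nonneg _) (hle z)
  have hvar := Real.pow_arith_mean_le_arith_mean_pow_of_even Finset.univ s (fun z => d z - v z)
    (fun z _ => hs z) hsum even_two
  have h₁ : ∑ z, s z * (d z - v z) = ∑ z, s z * d z - ∑ z, s z * v z := by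
    simp only [mul_sub, Finset.sum_sub_distrib]
  have h₂ : ∑ z, s z * (d z - v z) ^ 2 =
      ∑ z, s z * d z ^ 2 - 2 * ∑ z, s z * d z * v z + ∑ z, s z * v z ^ 2 := by
    rw [Finset.mul_sum, ← Finset.sum_sub_distrib, ← Finset.sum_add_distrib]
    exact Finset.sum_congr rfl fun z _ => by ring
  rw [h₁, h₂] at hvar
  nlinarith [hsq d, hsq v, sq_nonneg (∑ z, s z * d z), sq_nonneg (∑ z, s z * v z)]

/-- The weighted softmax map is nonexpansive for the Euclidean norm. -/
theorem sum_sq_softmax_sub_le {Z : Type*} [Fintype Z] [Nonempty Z] {w : Z → ℝ}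
    (hw : ∀ z, 0 < w z) (x y : Z → ℝ) :
    ∑ z, (w z * Real.exp (x z) / ∑ z', w z' * Real.exp (x z') -
        w z * Real.exp (y z) / ∑ z', w z' * Real.exp (y z')) ^ 2 ≤
      ∑ z, (x z - y z) ^ 2 := by
  set d : Z → ℝ := fun z => w z * Real.exp (x z) / ∑ z', w z' * Real.exp (x z') -
    w z * Real.exp (y z) / ∑ z', w z' * Real.exp (y z') with hd
  set v : Z → ℝ := fun z => x z - y z with hv
  let S : ℝ → ℝ := fun t => ∑ z, w z * Real.exp (y z + t * v z)
  let s : ℝ → Z → ℝ := fun t z => w z * Real.exp (y z + t * v z) / S t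
  have hS (t : ℝ) : 0 < S t := weightedExpSum_pos hw _
  have hs (t : ℝ) (z : Z) : 0 ≤ s t z :=
    div_nonneg (mul_pos (hw z) (Real.exp_pos _)).le (hS t).le
  have hsum (t : ℝ) : ∑ z, s t z = 1 := by
    simp only [s, ← Finset.sum_div]
    exact div_self (hS t).ne'
  have hder (t : ℝ) : HasDerivAt
      (fun t => (∑ z, (w z * d z) * Real.exp (y z + t * v z)) / S t)
      (∑ z, s t z * d z * v z - (∑ z, s t z * d z) * ∑ z, s t z * v z) t := by
    refine ((hasDerivAt_weightedExpSum (fun z => w z * d z) y v t).div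
      (hasDerivAt_weightedExpSum w y v t) (hS t).ne').congr_deriv ?_
    have e₁ : ∑ z, s t z * d z * v z =
        (∑ z, w z * d z * Real.exp (y z + t * v z) * v z) / S t := by
      rw [Finset.sum_div]
      exact Finset.sum_congr rfl fun z _ => by simp only [s]; ring
    have e₂ : ∑ z, s t z * d z = (∑ z, w z * d z * Real.exp (y z + t * v z)) / S t := by
      rw [Finset.sum_div]
      exact Finset.sum_congr rfl fun z _ => by simp only [s]; ring
    have e₃ : ∑ z, s t z * v z = (∑ z, w z * Real.exp (y z + t * v z) * v z) / S t := by
      rw [Finset.sum_div]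
      exact Finset.sum_congr rfl fun z _ => by simp only [s]; ring
    rw [e₁, e₂, e₃]
    change (_ * S t - _) / S t ^ 2 = _
    have := (hS t).ne'
    field_simp
  obtain ⟨t, -, ht⟩ := exists_hasDerivAt_eq_slope _ _ zero_lt_one
    (HasDerivAt.continuousOn fun t _ => hder t) (fun t _ => hder t)
  have hslope : ∑ z, s t z * d z * v z - (∑ z, s t z * d z) * ∑ z, s t z * v z =
      ∑ z, d z ^ 2 := by
    rw [ht]
    simp only [S, hv, one_mul, zero_mul, add_zero, add_sub_cancel, sub_zero, div_one]
    rw [Finset.sum_div, Finset.sum_div, ← Finset.sum_sub_distrib]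
    exact Finset.sum_congr rfl fun z _ => by
      rw [sq]
      nth_rw 4 [hd]
      ring
  have := two_mul_covariance_le (hs t) (hsum t) d v
  linarith

theorem gradient_lipschitz {Z : Type*} [Fintype Z] {p : ℕ} (hp : 0 < p)
    (π0 : Z → ℝ) (h0pos : ∀ z, 0 < π0 z) (h0sum : ∑ z, π0 z = 1)
    (πs : Fin p → Z → ℝ) (hsnn : ∀ i z, 0 ≤ πs i z)
    (hssum : ∀ i, ∑ z, πs i z = 1)
    (γ : Fin p → ℝ) (hγ : ∀ i, 0 < γ i) :
    Differentiable ℝ (hobj π0 πs γ) ∧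
    (∀ X V : Matrix (Fin p) Z ℝ,
      HasDerivAt (fun t : ℝ => hobj π0 πs γ (X + t • V))
        (∑ i, ∑ z, gradh π0 πs γ X i z * V i z) 0) ∧
    (∀ X₁ X₂ : Matrix (Fin p) Z ℝ,
      fnorm (gradh π0 πs γ X₁ - gradh π0 πs γ X₂) ≤
        ((1 / (p : ℝ)) *
            Finset.univ.sup'
              (Finset.univ_nonempty_iff.mpr (Fin.pos_iff_nonempty.mp hp)) γ) *
          fnorm (X₁ - X₂)) := by
  have : Nonempty Z := by
    by_contra h
    rw [not_nonempty_iff] at h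
    simp at h0sum
  refine ⟨?_, fun X V => ?_, fun X₁ X₂ => ?_⟩
  · have hentry (i : Fin p) (z : Z) : Differentiable ℝ fun X : Matrix (Fin p) Z ℝ => X i z :=
      (Matrix.entryLinearMap ℝ ℝ i z).toContinuousLinearMap.differentiable
    refine Differentiable.const_mul (Differentiable.fun_sum fun i _ =>
      Differentiable.const_mul (Differentiable.sub ?_ (Differentiable.log ?_ fun X => ?_)) _) _
    · exact Differentiable.fun_sum fun z _ => (hentry i z).const_mul _
    · exact Differentiable.fun_sum fun z _ => (hentry i z).exp.const_mul _
    · exact (weightedExpSum_pos h0pos (X i)).ne'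
  · have hrow (i : Fin p) : HasDerivAt
        (fun t : ℝ => γ i * ((∑ z, πs i z * (X i z + t * V i z)) -
          Real.log (∑ z, π0 z * Real.exp (X i z + t * V i z))))
        (γ i * ((∑ z, πs i z * V i z) -
          (∑ z, π0 z * Real.exp (X i z + 0 * V i z) * V i z) /
            ∑ z, π0 z * Real.exp (X i z + 0 * V i z))) 0 := by
      refine HasDerivAt.const_mul _ (HasDerivAt.sub (HasDerivAt.fun_sum fun z _ => ?_)
        ((hasDerivAt_weightedExpSum π0 (X i) (V i) 0).log (weightedExpSum_pos h0pos _).ne'))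
      simpa using (((hasDerivAt_id (0 : ℝ)).mul_const (V i z)).const_add (X i z)).const_mul
        (πs i z)
    refine ((HasDerivAt.fun_sum (u := Finset.univ) fun i _ => hrow i).const_mul
      (1 / (p : ℝ))).congr_deriv ?_
    rw [Finset.mul_sum]
    refine Finset.sum_congr rfl fun i _ => ?_
    simp only [gradh, Matrix.of_apply, zero_mul, add_zero]
    rw [Finset.sum_div, ← Finset.sum_sub_distrib, Finset.mul_sum, Finset.mul_sum]
    exact Finset.sum_congr rfl fun z _ => by ring
  · set M := Finset.univ.sup'
      (Finset.univ_nonempty_iff.mpr (Fin.pos_iff_nonempty.mp hp)) γ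
    have hγM (i : Fin p) : γ i ≤ M := Finset.le_sup' γ (Finset.mem_univ i)
    have hL : 0 ≤ 1 / (p : ℝ) * M :=
      mul_nonneg (by positivity) ((hγ ⟨0, hp⟩).le.trans (hγM _))
    rw [fnorm, fnorm, ← Real.sqrt_sq hL, ← Real.sqrt_mul (sq_nonneg _), Finset.mul_sum]
    refine Real.sqrt_le_sqrt (Finset.sum_le_sum fun i _ => ?_)
    have hcoef : (γ i / (p : ℝ)) ^ 2 ≤ (1 / (p : ℝ) * M) ^ 2 := by
      rw [div_eq_mul_one_div, mul_comm]
      have := hγ i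
      have := hγM i
      gcongr
    calc ∑ z, (gradh π0 πs γ X₁ - gradh π0 πs γ X₂) i z ^ 2
        = (γ i / (p : ℝ)) ^ 2 * ∑ z,
            (π0 z * Real.exp (X₁ i z) / ∑ z', π0 z' * Real.exp (X₁ i z') -
              π0 z * Real.exp (X₂ i z) / ∑ z', π0 z' * Real.exp (X₂ i z')) ^ 2 := by
          rw [Finset.mul_sum]
          refine Finset.sum_congr rfl fun z _ => ?_
          simp only [gradh, Matrix.sub_apply, Matrix.of_apply]
          ring
      _ ≤ (1 / (p : ℝ) * M) ^ 2 * ∑ z, (X₁ - X₂) i z ^ 2 :=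
          mul_le_mul hcoef (sum_sq_softmax_sub_le h0pos (X₁ i) (X₂ i))
            (Finset.sum_nonneg fun _ _ => sq_nonneg _) (sq_nonneg _)
end

section
/- Let Z be a finite set, let π⁰, π¹, …, π^p ∈ P(Z) with π⁰ of full support, and let γ₁,…,γ_p > 0. Define h on p×|Z| real matrices by h(X) = (1/p) Σ_{i=1}^p γ_i (⟨πⁱ, X_i⟩ − log⟨π⁰, e^{X_i}⟩), where X_i is the i-th row of X viewed as a function on Z. Suppose X̄ is a local maximum of h on S = {X : rank(X) ≤ d} (there exists δ > 0 such that h(X) ≤ h(X̄) for all X ∈ S with ‖X − X̄‖ ≤ δ) and rank(X̄) = d. Let H = {X̄W₁ + W₂X̄ : W₁ ∈ ℝ^{|Z|×|Z|}, W₂ ∈ ℝ^{p×p}}. Then X̄ is also a local maximum of h on H: there exists δ′ > 0 such that h(Y) ≤ h(X̄) for all Y ∈ H with ‖Y − X̄‖ ≤ δ′. -/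
/-- The derivative of `hobj` at `X` in the direction `D`. -/
noncomputable def hobjDeriv {Z : Type*} [Fintype Z] {p : ℕ} (π0 : Z → ℝ)
    (πs : Fin p → Z → ℝ) (γ : Fin p → ℝ) (X D : Matrix (Fin p) Z ℝ) : ℝ :=
  (1 / (p : ℝ)) * ∑ i, γ i *
    ((∑ z, πs i z * D i z) -
      (∑ z, π0 z * (Real.exp (X i z) * D i z)) / ∑ z, π0 z * Real.exp (X i z))

lemma sum_mul_exp_pos {Z : Type*} [Fintype Z] {π0 : Z → ℝ} (h0pos : ∀ z, 0 < π0 z)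
    (h0sum : ∑ z, π0 z = 1) (x : Z → ℝ) : 0 < ∑ z, π0 z * Real.exp (x z) := by
  have hne : (Finset.univ : Finset Z).Nonempty := by
    by_contra h
    rw [Finset.not_nonempty_iff_eq_empty] at h
    simp [h] at h0sum
  exact Finset.sum_pos (fun z _ => mul_pos (h0pos z) (Real.exp_pos _)) hne

/-- The gradient inequality for the convex function `x ↦ log ⟨π0, exp x⟩`. -/
lemma log_sum_exp_add_div_le {Z : Type*} [Fintype Z] {π0 : Z → ℝ} (h0pos : ∀ z, 0 < π0 z)
    (h0sum : ∑ z, π0 z = 1) (x y : Z → ℝ) :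
    Real.log (∑ z, π0 z * Real.exp (x z)) +
      (∑ z, π0 z * (Real.exp (x z) * (y z - x z))) / (∑ z, π0 z * Real.exp (x z)) ≤
      Real.log (∑ z, π0 z * Real.exp (y z)) := by
  have hx := sum_mul_exp_pos h0pos h0sum x
  have hy := sum_mul_exp_pos h0pos h0sum y
  set s := ∑ z, π0 z * Real.exp (x z) with hs
  have hJ := convexOn_exp.map_sum_le (t := Finset.univ)
    (w := fun z => π0 z * Real.exp (x z) / s) (p := fun z => y z - x z)
    (fun z _ => by have := h0pos z; positivity)
    (by rw [← Finset.sum_div, ← hs, div_self hx.ne']) (fun z _ => Set.mem_univ _)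
  have h1 : ∑ z, (π0 z * Real.exp (x z) / s) • (y z - x z) =
      (∑ z, π0 z * (Real.exp (x z) * (y z - x z))) / s := by
    rw [Finset.sum_div]
    exact Finset.sum_congr rfl fun z _ => by rw [smul_eq_mul]; ring
  have h2 : ∑ z, (π0 z * Real.exp (x z) / s) • Real.exp (y z - x z) =
      (∑ z, π0 z * Real.exp (y z)) / s := by
    rw [Finset.sum_div]
    refine Finset.sum_congr rfl fun z _ => ?_
    rw [smul_eq_mul, Real.exp_sub]
    field_simp
  rw [h1, h2, ← Real.le_log_iff_exp_le (by positivity), Real.log_div hy.ne' hx.ne'] at hJ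
  linarith

/-- The gradient inequality for the concave function `hobj`. -/
lemma hobj_le_add_hobjDeriv {Z : Type*} [Fintype Z] {p : ℕ} {π0 : Z → ℝ}
    (h0pos : ∀ z, 0 < π0 z) (h0sum : ∑ z, π0 z = 1) (πs : Fin p → Z → ℝ)
    {γ : Fin p → ℝ} (hγ : ∀ i, 0 < γ i) (X Y : Matrix (Fin p) Z ℝ) :
    hobj π0 πs γ Y ≤ hobj π0 πs γ X + hobjDeriv π0 πs γ X (Y - X) := by
  unfold hobj hobjDeriv
  rw [← mul_add, ← Finset.sum_add_distrib]
  refine mul_le_mul_of_nonneg_left (Finset.sum_le_sum fun i _ => ?_) (by positivity)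
  rw [← mul_add]
  refine mul_le_mul_of_nonneg_left ?_ (hγ i).le
  have h := log_sum_exp_add_div_le h0pos h0sum (X i) (Y i)
  simp only [Matrix.sub_apply]
  have h' : ∑ z, πs i z * (Y i z - X i z) = ∑ z, πs i z * Y i z - ∑ z, πs i z * X i z := by
    simp only [mul_sub, Finset.sum_sub_distrib]
  linarith

/-- The chain rule for `hobj` along a curve of matrices. -/
lemma hasDerivAt_hobj_comp {Z : Type*} [Fintype Z] {p : ℕ} {π0 : Z → ℝ}
    (h0pos : ∀ z, 0 < π0 z) (h0sum : ∑ z, π0 z = 1) (πs : Fin p → Z → ℝ)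
    (γ : Fin p → ℝ) {c : ℝ → Matrix (Fin p) Z ℝ} {D : Matrix (Fin p) Z ℝ} {t : ℝ}
    (hc : ∀ i z, HasDerivAt (fun s => c s i z) (D i z) t) :
    HasDerivAt (fun s => hobj π0 πs γ (c s)) (hobjDeriv π0 πs γ (c t) D) t := by
  unfold hobj hobjDeriv
  refine (HasDerivAt.fun_sum fun i _ => HasDerivAt.const_mul _ (HasDerivAt.sub ?_ ?_)).const_mul _
  · exact HasDerivAt.fun_sum fun z _ => (hc i z).const_mul _
  · exact (HasDerivAt.fun_sum fun z _ => ((hc i z).exp).const_mul _).log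
      (sum_mul_exp_pos h0pos h0sum (c t i)).ne'

theorem local_max_on_S_implies_local_max_on_H {Z : Type*} [Fintype Z] {p : ℕ}
    (π0 : Z → ℝ) (h0pos : ∀ z, 0 < π0 z) (h0sum : ∑ z, π0 z = 1)
    (πs : Fin p → Z → ℝ) (hsnn : ∀ i z, 0 ≤ πs i z)
    (hssum : ∀ i, ∑ z, πs i z = 1)
    (γ : Fin p → ℝ) (hγ : ∀ i, 0 < γ i)
    (d : ℕ) (Xbar : Matrix (Fin p) Z ℝ) (hrank : Xbar.rank = d)
    (δ : ℝ) (hδ : 0 < δ)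
    (hmax : ∀ X : Matrix (Fin p) Z ℝ, X.rank ≤ d → fnorm (X - Xbar) ≤ δ →
      hobj π0 πs γ X ≤ hobj π0 πs γ Xbar) :
    ∃ δ' > (0 : ℝ), ∀ Y : Matrix (Fin p) Z ℝ,
      (∃ (W₁ : Matrix Z Z ℝ) (W₂ : Matrix (Fin p) (Fin p) ℝ),
        Y = Xbar * W₁ + W₂ * Xbar) →
      fnorm (Y - Xbar) ≤ δ' → hobj π0 πs γ Y ≤ hobj π0 πs γ Xbar := by
  classical
  refine ⟨1, one_pos, ?_⟩
  rintro Y ⟨W₁, W₂, hY⟩ -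
  -- A curve of matrices of rank at most `d`, tangent to `Y - Xbar` at `Xbar`.
  let c : ℝ → Matrix (Fin p) Z ℝ := fun t => (1 + t • (W₂ - 1)) * Xbar * (1 + t • W₁)
  have hc0 : c 0 = Xbar := by simp [c]
  have hexp : ∀ t, c t = Xbar + t • (Y - Xbar) + t ^ 2 • ((W₂ - 1) * Xbar * W₁) := by
    intro t
    simp only [c, hY, Matrix.add_mul, Matrix.mul_add, Matrix.sub_mul, Matrix.one_mul,
      Matrix.mul_one, Matrix.smul_mul, Matrix.mul_smul, smul_add, smul_sub, smul_smul, pow_two]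
    abel
  have hrk : ∀ t, (c t).rank ≤ d := fun t =>
    ((Matrix.rank_mul_le_left _ _).trans (Matrix.rank_mul_le_right _ _)).trans hrank.le
  have hderiv : ∀ i z, HasDerivAt (fun s => c s i z) ((Y - Xbar) i z) 0 := by
    intro i z
    have h := (((hasDerivAt_id (0 : ℝ)).mul_const ((Y - Xbar) i z)).const_add (Xbar i z)).add
      ((hasDerivAt_pow 2 (0 : ℝ)).mul_const (((W₂ - 1) * Xbar * W₁ : Matrix (Fin p) Z ℝ) i z))
    refine (h.congr_deriv (by simp)).congr_of_eventuallyEq (Filter.Eventually.of_forall fun t => ?_)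
    simp [hexp]
  have hcont : ContinuousAt (fun t => fnorm (c t - Xbar)) 0 := by
    refine ContinuousAt.sqrt ?_
    refine tendsto_finsetSum _ fun i _ => tendsto_finsetSum _ fun z _ => ?_
    exact ((hderiv i z).continuousAt.sub continuousAt_const).pow 2
  have hmaxc : IsLocalMax (fun t => hobj π0 πs γ (c t)) 0 := by
    have h0 : fnorm (c 0 - Xbar) < δ := by simpa [hc0, fnorm] using hδ
    filter_upwards [hcont.eventually_lt_const h0] with t ht
    simpa only [hc0] using hmax (c t) (hrk t) ht.le
  have hzero := hmaxc.hasDerivAt_eq_zero (hasDerivAt_hobj_comp h0pos h0sum πs γ hderiv)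
  rw [hc0] at hzero
  simpa [hzero] using hobj_le_add_hobjDeriv h0pos h0sum πs hγ Xbar Y
end
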